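/- Let V: ℝ^d → ℝ be continuous with ∫ e^{V(x)} dx = 1 and let μ(dx) = e^{V(x)} dx. Assume there is c > 0 such that the super Poincaré inequality ∫ f² dμ ≤ r ∫ |∇f|² dμ + exp[c(1 + r^{-1/2})] (∫ |f| dμ)² holds for all r > 0 and all f ∈ C_c^∞(ℝ^d). Then there exist constants C > 0 and c₁ > 0 such that for every f ∈ C_c^∞(ℝ^d) with ∫ f² dμ = 1, one has ∫ f² log f² dμ ≤ C ∫ e^{-c₁ |x|} |∇f(x)|² μ(dx). -/

import Mathlib

open MeasureTheory Real Set

noncomputable abbrev T : ℝ → ℝ := Real.smoothTransition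

lemma T_cd : ContDiff ℝ (⊤ : ℕ∞) T := Real.smoothTransition.contDiff

lemma T_deriv_zero {t : ℝ} (h : t ≤ 0 ∨ 1 ≤ t) : deriv T t = 0 := by
  rcases h with h | h
  · apply IsLocalMin.deriv_eq_zero
    refine Filter.Eventually.of_forall fun y => ?_
    show T t ≤ T y
    rw [show T t = 0 from Real.smoothTransition.zero_of_nonpos h]
    exact Real.smoothTransition.nonneg y
  · apply IsLocalMax.deriv_eq_zero
    refine Filter.Eventually.of_forall fun y => ?_
    show T y ≤ T t
    rw [show T t = 1 from Real.smoothTransition.one_of_one_le h]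
    exact Real.smoothTransition.le_one y

lemma T_deriv_bdd : ∃ L : ℝ, 1 ≤ L ∧ ∀ t, |deriv T t| ≤ L := by
  have hc : Continuous (deriv T) := T_cd.continuous_deriv (by simp)
  obtain ⟨C, hC⟩ := (isCompact_Icc (a := (0:ℝ)) (b := 1)).exists_bound_of_continuousOn hc.continuousOn
  refine ⟨max 1 C, le_max_left _ _, fun t => ?_⟩
  by_cases h : t ∈ Icc (0:ℝ) 1
  · exact (hC t h).trans (le_max_right _ _)
  · rw [T_deriv_zero]
    · simp
    · by_contra h'
      push Not at h'
      exact h ⟨h'.1.le, h'.2.le⟩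

section
variable {d : ℕ}
local notation "E" => EuclideanSpace ℝ (Fin d)

noncomputable def rho (x : EuclideanSpace ℝ (Fin d)) : ℝ := √(1 + ‖x‖ ^ 2)

lemma rho_cd : ContDiff ℝ (⊤ : ℕ∞) (rho (d := d)) := by
  unfold rho
  apply ContDiff.sqrt
  · exact contDiff_const.add (contDiff_norm_sq ℝ)
  · intro x; positivity

lemma norm_le_rho (x : E) : ‖x‖ ≤ rho x := by
  unfold rho
  apply Real.le_sqrt_of_sq_le; linarith

lemma one_le_rho (x : E) : 1 ≤ rho x := by
  unfold rho
  apply Real.le_sqrt_of_sq_le; nlinarith [sq_nonneg ‖x‖]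

lemma rho_fderiv (x : E) : ‖fderiv ℝ (rho (d := d)) x‖ ≤ 1 := by
  have h : LipschitzWith 1 (rho (d := d)) := by
    apply LipschitzWith.of_le_add
    intro x y
    have h1 : ‖x‖ ≤ ‖y‖ + dist x y := by
      rw [dist_eq_norm]
      have := norm_add_le y (x - y); simpa using this
    have h2 := norm_le_rho y
    have h3 : rho y ^ 2 = 1 + ‖y‖ ^ 2 := Real.sq_sqrt (by positivity)
    have h4 : 0 ≤ dist x y := dist_nonneg
    have h5 := one_le_rho y
    apply Real.sqrt_le_iff.2 ⟨by linarith, ?_⟩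
    nlinarith [norm_nonneg x, norm_nonneg y]
  exact_mod_cast norm_fderiv_le_of_lipschitz ℝ h

/-- chain rule with a scalar outer function -/
lemma fderiv_comp_scalar {φ : ℝ → ℝ} {f : E → ℝ} (hφ : ContDiff ℝ (⊤ : ℕ∞) φ)
    (hf : ContDiff ℝ (⊤ : ℕ∞) f) (x : E) :
    ‖fderiv ℝ (fun x => φ (f x)) x‖ = |deriv φ (f x)| * ‖fderiv ℝ f x‖ := by
  have h1 : HasFDerivAt f (fderiv ℝ f x) x := ((hf.differentiable (by simp)) x).hasFDerivAt
  have h2 : HasDerivAt φ (deriv φ (f x)) (f x) := ((hφ.differentiable (by simp)) _).hasDerivAt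
  have h3 := h2.comp_hasFDerivAt x h1
  have h4 : fderiv ℝ (fun x => φ (f x)) x = deriv φ (f x) • fderiv ℝ f x := h3.fderiv
  rw [h4, norm_smul, Real.norm_eq_abs]

lemma fderiv_mul_sq {f g : E → ℝ} (hf : ContDiff ℝ (⊤ : ℕ∞) f)
    (hg : ContDiff ℝ (⊤ : ℕ∞) g) (x : E) :
    ‖fderiv ℝ (fun x => f x * g x) x‖ ^ 2 ≤
      2 * (f x ^ 2 * ‖fderiv ℝ g x‖ ^ 2 + g x ^ 2 * ‖fderiv ℝ f x‖ ^ 2) := by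
  have h1 := ((hf.differentiable (by simp)) x)
  have h2 := ((hg.differentiable (by simp)) x)
  have h : ‖fderiv ℝ (fun x => f x * g x) x‖ ≤ |f x| * ‖fderiv ℝ g x‖ + |g x| * ‖fderiv ℝ f x‖ := by
    rw [fderiv_fun_mul h1 h2]
    refine (norm_add_le _ _).trans ?_
    rw [norm_smul, norm_smul]; simp
  have h0 := norm_nonneg (fderiv ℝ (fun x => f x * g x) x)
  rw [← sq_abs (f x), ← sq_abs (g x)]
  nlinarith [sq_nonneg (|f x| * ‖fderiv ℝ g x‖ - |g x| * ‖fderiv ℝ f x‖),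
    mul_nonneg (abs_nonneg (f x)) (norm_nonneg (fderiv ℝ g x)),
    mul_nonneg (abs_nonneg (g x)) (norm_nonneg (fderiv ℝ f x))]

/-- cutoffs `T (α ρ + b)` -/
noncomputable def cut (α b : ℝ) (x : EuclideanSpace ℝ (Fin d)) : ℝ := T (α * rho x + b)

lemma cut_cd (α b : ℝ) : ContDiff ℝ (⊤ : ℕ∞) (cut (d := d) α b) :=
  T_cd.comp ((contDiff_const.mul rho_cd).add contDiff_const)

lemma cut_nonneg (α b : ℝ) (x : E) : 0 ≤ cut α b x := Real.smoothTransition.nonneg _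
lemma cut_le_one (α b : ℝ) (x : E) : cut α b x ≤ 1 := Real.smoothTransition.le_one _
lemma cut_zero {α b : ℝ} {x : E} (h : α * rho x + b ≤ 0) : cut α b x = 0 :=
  Real.smoothTransition.zero_of_nonpos h
lemma cut_one {α b : ℝ} {x : E} (h : 1 ≤ α * rho x + b) : cut α b x = 1 :=
  Real.smoothTransition.one_of_one_le h

lemma cut_fderiv_eq (α b : ℝ) (x : E) :
    ‖fderiv ℝ (cut (d := d) α b) x‖ = |deriv T (α * rho x + b)| * (|α| * ‖fderiv ℝ (rho (d := d)) x‖) := by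
  have h := fderiv_comp_scalar (f := fun x : E => α * rho x + b) T_cd
    ((contDiff_const.mul rho_cd).add contDiff_const) x
  have h2 : fderiv ℝ (fun x : E => α * rho x + b) x = α • fderiv ℝ (rho (d := d)) x := by
    rw [fderiv_add_const, fderiv_const_mul ((rho_cd.differentiable (by simp)) x)]
  rw [h2, norm_smul] at h
  exact h

lemma cut_fderiv_le {L : ℝ} (hL : ∀ t, |deriv T t| ≤ L) (α b : ℝ) (x : E) :
    ‖fderiv ℝ (cut (d := d) α b) x‖ ≤ L * |α| := by
  rw [cut_fderiv_eq]
  have := rho_fderiv x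
  have h2 := hL (α * rho x + b)
  calc _ ≤ |deriv T (α * rho x + b)| * (|α| * 1) := by gcongr
    _ ≤ _ := by rw [mul_one]; gcongr

lemma cut_fderiv_zero {α b : ℝ} {x : E} (h : α * rho x + b ≤ 0 ∨ 1 ≤ α * rho x + b) :
    ‖fderiv ℝ (cut (d := d) α b) x‖ = 0 := by
  rw [cut_fderiv_eq, T_deriv_zero h]; simp

lemma hcs_of_rho {f : E → ℝ} {R : ℝ} (h : ∀ x, R ≤ rho x → f x = 0) : HasCompactSupport f := by
  apply HasCompactSupport.intro (isCompact_closedBall (0 : E) R)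
  intro x hx
  apply h
  rw [Metric.mem_closedBall, dist_zero_right, not_le] at hx
  exact hx.le.trans (norm_le_rho x)

/-- super Poincare inequality in the parametrisation `r = q⁻²` -/
def SPI (μ : Measure (EuclideanSpace ℝ (Fin d))) (c : ℝ) : Prop :=
  ∀ q > (0:ℝ), ∀ f : EuclideanSpace ℝ (Fin d) → ℝ,
      ContDiff ℝ (⊤ : ℕ∞) f → HasCompactSupport f →
      ∫ x, f x ^ 2 ∂μ ≤ (q ^ 2)⁻¹ * ∫ x, ‖fderiv ℝ f x‖ ^ 2 ∂μ
        + Real.exp (c * (1 + q)) * (∫ x, |f x| ∂μ) ^ 2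

lemma int_cs {μ : Measure E} [IsFiniteMeasure μ] {f : E → ℝ} (hf : Continuous f)
    (hs : HasCompactSupport f) : Integrable f μ := hf.integrable_of_hasCompactSupport hs

lemma cs_ineq {μ : Measure E} [IsProbabilityMeasure μ] {g : E → ℝ} (hg : Continuous g)
    (hs : HasCompactSupport g) {A : Set E} (hA : MeasurableSet A) (h0 : ∀ x, x ∉ A → g x = 0) :
    (∫ x, |g x| ∂μ) ^ 2 ≤ μ.real A * ∫ x, g x ^ 2 ∂μ := by
  set I := ∫ x, |g x| ∂μ
  set J := ∫ x, g x ^ 2 ∂μ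
  have i1 : Integrable (fun x => |g x|) μ := (int_cs hg hs).abs
  have i2 : Integrable (fun x => g x ^ 2) μ :=
    int_cs (hg.pow 2) (hs.comp_left (g := fun t : ℝ => t ^ 2) (by simp))
  have i3 : Integrable (A.indicator (fun _ : E => (1:ℝ))) μ :=
    (integrable_const (1:ℝ)).indicator hA
  have key : ∀ s : ℝ, 0 ≤ J - 2 * s * I + s ^ 2 * μ.real A := by
    intro s
    have h1 : 0 ≤ ∫ x, (g x ^ 2 - 2 * s * |g x| + s ^ 2 * A.indicator (fun _ : E => (1:ℝ)) x) ∂μ := by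
      apply integral_nonneg
      intro x
      show 0 ≤ g x ^ 2 - 2 * s * |g x| + s ^ 2 * A.indicator (fun _ : E => (1:ℝ)) x
      by_cases hx : x ∈ A
      · rw [indicator_of_mem hx, ← sq_abs (g x)]; nlinarith [sq_nonneg (|g x| - s)]
      · rw [indicator_of_notMem hx, h0 x hx]; simp
    have i4 : Integrable (fun x => g x ^ 2 - 2 * s * |g x|) μ := i2.sub (i1.const_mul _)
    rw [integral_add i4 (i3.const_mul _),
      integral_sub i2 (i1.const_mul _), integral_const_mul, integral_const_mul,
      integral_indicator_const _ hA] at h1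
    simpa using h1
  have hP : 0 ≤ μ.real A := measureReal_nonneg
  have hJ : 0 ≤ J := integral_nonneg fun x => sq_nonneg _
  rcases hP.eq_or_lt with h | h
  · by_contra hcon
    rw [← h] at hcon key
    have hI : I ≠ 0 := by rintro h; simp [h] at hcon
    have := key ((J + 1) / (2 * I))
    have h5 : 2 * ((J + 1) / (2 * I)) * I = J + 1 := by field_simp
    rw [h5] at this
    linarith
  · have := key (I / μ.real A)
    field_simp at this
    nlinarith

lemma cd_norm_cont {f : E → ℝ} (hf : ContDiff ℝ (⊤ : ℕ∞) f) :
    Continuous fun x => ‖fderiv ℝ f x‖ ^ 2 :=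
  ((hf.continuous_fderiv (by simp)).norm).pow 2

lemma key_SP {μ : Measure E} [IsProbabilityMeasure μ] {c : ℝ} (hSP : SPI μ c) {q : ℝ} (hq : 0 < q)
    {g : E → ℝ} (hg : ContDiff ℝ (⊤ : ℕ∞) g) (hs : HasCompactSupport g) {A : Set E}
    (hA : MeasurableSet A) (h0 : ∀ x, x ∉ A → g x = 0)
    (hq2 : Real.exp (c * (1 + q)) * μ.real A ≤ 1 / 2) :
    ∫ x, g x ^ 2 ∂μ ≤ 2 * (q ^ 2)⁻¹ * ∫ x, ‖fderiv ℝ g x‖ ^ 2 ∂μ := by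
  have h1 := hSP q hq g hg hs
  have h2 := cs_ineq (μ := μ) hg.continuous hs hA h0
  have hJ : 0 ≤ ∫ x, g x ^ 2 ∂μ := integral_nonneg fun x => sq_nonneg _
  have h3 : Real.exp (c * (1 + q)) * (∫ x, |g x| ∂μ) ^ 2 ≤ 1 / 2 * ∫ x, g x ^ 2 ∂μ := by
    calc _ ≤ Real.exp (c * (1 + q)) * (μ.real A * ∫ x, g x ^ 2 ∂μ) := by gcongr
      _ = (Real.exp (c * (1 + q)) * μ.real A) * ∫ x, g x ^ 2 ∂μ := by ring
      _ ≤ _ := by gcongr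
  linarith

end

section
variable {d : ℕ}
local notation "E" => EuclideanSpace ℝ (Fin d)

lemma int_bdd {μ : Measure E} [IsProbabilityMeasure μ] {f : E → ℝ} (hf : Continuous f) {C : ℝ}
    (h : ∀ x, |f x| ≤ C) : Integrable f μ :=
  Integrable.of_bound hf.aestronglyMeasurable C (Filter.Eventually.of_forall h)

lemma rho_ge_meas (s : ℝ) : MeasurableSet {x : E | s ≤ rho x} :=
  measurableSet_le measurable_const rho_cd.continuous.measurable

/-- tail function -/
noncomputable def tail (μ : Measure (EuclideanSpace ℝ (Fin d))) (s : ℝ) : ℝ :=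
  μ.real {x | s ≤ rho x}

lemma tail_anti (μ : Measure E) [IsProbabilityMeasure μ] {s t : ℝ} (h : s ≤ t) :
    tail μ t ≤ tail μ s :=
  measureReal_mono (fun _ hx => h.trans hx)

lemma tail_nonneg (μ : Measure E) (s : ℝ) : 0 ≤ tail μ s := measureReal_nonneg

lemma tail_tendsto (μ : Measure E) [IsProbabilityMeasure μ] :
    Filter.Tendsto (fun n : ℕ => tail μ n) Filter.atTop (nhds 0) := by
  have h := tendsto_measure_iInter_atTop (μ := μ) (s := fun n : ℕ => {x : E | (n:ℝ) ≤ rho x})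
    (fun n => (rho_ge_meas _).nullMeasurableSet)
    (fun m n hmn x hx => le_trans (by exact_mod_cast hmn) (show (n:ℝ) ≤ rho x from hx)) ⟨0, measure_ne_top _ _⟩
  have h2 : (⋂ n : ℕ, {x : E | (n:ℝ) ≤ rho x}) = ∅ := by
    ext x
    simp only [mem_iInter, mem_ofPred_eq, mem_empty_iff_false, iff_false, not_forall, not_le]
    exact exists_nat_gt (rho x)
  rw [h2, measure_empty] at h
  have := (ENNReal.tendsto_toReal ENNReal.zero_ne_top).comp h
  simpa [tail, Measure.real, Function.comp_def] using this

lemma sq_mul_le {a b M : ℝ} (h0 : 0 ≤ a) (h1 : a ≤ 1) (hb : 0 ≤ b) (hM : b ≤ M) :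
    a ^ 2 * b ≤ M :=
  (mul_le_of_le_one_left hb (pow_le_one₀ h0 h1)).trans hM

lemma tail_step0 {μ : Measure E} [IsProbabilityMeasure μ] {c : ℝ} (hSP : SPI μ c) {L : ℝ}
    (hL : ∀ t, |deriv T t| ≤ L) {q δ : ℝ} (hq : 0 < q) (hδ : 0 < δ) (s : ℝ) :
    tail μ (s + δ) ≤ (q ^ 2)⁻¹ * (2 * (L / δ) ^ 2 * tail μ s)
      + Real.exp (c * (1 + q)) * tail μ s ^ 2 := by
  have main : ∀ N : ℕ, tail μ (s + δ) - tail μ N ≤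
      (q ^ 2)⁻¹ * (2 * (L / δ) ^ 2 * tail μ s + 2 * L ^ 2 * tail μ N)
      + Real.exp (c * (1 + q)) * tail μ s ^ 2 := by
    intro N
    set a : E → ℝ := cut δ⁻¹ (-(s / δ)) with ha
    set b : E → ℝ := cut (-1) (N + 1) with hb
    have ea : ∀ x : E, δ⁻¹ * rho x + (-(s / δ)) = (rho x - s) / δ := fun x => by ring
    have hcd : ContDiff ℝ (⊤ : ℕ∞) (fun x => a x * b x) := (cut_cd _ _).mul (cut_cd _ _)
    have hcs : HasCompactSupport (fun x => a x * b x) := by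
      apply hcs_of_rho (R := N + 1)
      intro x hx
      have : b x = 0 := cut_zero (by linarith)
      simp [this]
    have hA : ∀ x, x ∉ {x : E | s ≤ rho x} → a x = 0 := by
      intro x hx
      apply cut_zero
      rw [ea]
      simp only [mem_ofPred_eq, not_le] at hx
      exact div_nonpos_of_nonpos_of_nonneg (by linarith) hδ.le
    have h1 := hSP q hq _ hcd hcs
    have ind : ∀ t : ℝ, Integrable ({x : E | t ≤ rho x}.indicator (fun _ : E => (1:ℝ))) μ :=
      fun t => (integrable_const (1:ℝ)).indicator (rho_ge_meas t)
    have indv : ∀ t : ℝ, ∫ x, {x : E | t ≤ rho x}.indicator (fun _ : E => (1:ℝ)) x ∂μ = tail μ t := by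
      intro t
      rw [integral_indicator_const _ (rho_ge_meas t)]; simp [tail]
    have i2 : Integrable (fun x => (a x * b x) ^ 2) μ :=
      int_cs (hcd.continuous.pow 2) (hcs.comp_left (g := fun t : ℝ => t ^ 2) (by simp))
    have l1 : tail μ (s + δ) - tail μ N ≤ ∫ x, (a x * b x) ^ 2 ∂μ := by
      rw [← indv, ← indv, ← integral_sub (ind _) (ind _)]
      apply integral_mono ((ind _).sub (ind _)) i2
      intro x
      show {x : E | s + δ ≤ rho x}.indicator (fun _ : E => (1:ℝ)) x -
        {x : E | (N:ℝ) ≤ rho x}.indicator (fun _ : E => (1:ℝ)) x ≤ (a x * b x) ^ 2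
      by_cases h1 : s + δ ≤ rho x
      · by_cases h2 : (N:ℝ) ≤ rho x
        · rw [indicator_of_mem (by exact h1), indicator_of_mem (by exact h2)]
          simpa using sq_nonneg _
        · have e1 : a x = 1 := by
            apply cut_one; rw [ea, le_div_iff₀ hδ]; linarith
          have e2 : b x = 1 := by
            apply cut_one; push Not at h2; linarith
          rw [indicator_of_mem (by exact h1), indicator_of_notMem (by exact h2), e1, e2]; norm_num
      · rw [indicator_of_notMem (by exact h1)]
        have : 0 ≤ {x : E | (N:ℝ) ≤ rho x}.indicator (fun _ : E => (1:ℝ)) x :=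
          indicator_nonneg (fun _ _ => by norm_num) _
        nlinarith [sq_nonneg (a x * b x)]
    have i3 : Integrable (fun x => 2 * (L / δ) ^ 2 * {x : E | s ≤ rho x}.indicator (fun _ : E => (1:ℝ)) x
        + 2 * L ^ 2 * {x : E | (N:ℝ) ≤ rho x}.indicator (fun _ : E => (1:ℝ)) x) μ :=
      ((ind s).const_mul _).add ((ind N).const_mul _)
    have l2 : ∫ x, ‖fderiv ℝ (fun x => a x * b x) x‖ ^ 2 ∂μ ≤
        2 * (L / δ) ^ 2 * tail μ s + 2 * L ^ 2 * tail μ N := by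
      rw [← indv, ← indv, ← integral_const_mul, ← integral_const_mul,
        ← integral_add ((ind s).const_mul _) ((ind N).const_mul _)]
      apply integral_mono_of_nonneg (Filter.Eventually.of_forall fun x => sq_nonneg _) i3
      refine Filter.Eventually.of_forall fun x => ?_
      refine (fderiv_mul_sq (cut_cd _ _) (cut_cd _ _) x).trans ?_
      show 2 * (a x ^ 2 * ‖fderiv ℝ b x‖ ^ 2 + b x ^ 2 * ‖fderiv ℝ a x‖ ^ 2) ≤ _
      have a0 : 0 ≤ a x := cut_nonneg _ _ _
      have a1 : a x ≤ 1 := cut_le_one _ _ _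
      have b0 : 0 ≤ b x := cut_nonneg _ _ _
      have b1 : b x ≤ 1 := cut_le_one _ _ _
      have t1 : a x ^ 2 * ‖fderiv ℝ b x‖ ^ 2 ≤
          L ^ 2 * {x : E | (N:ℝ) ≤ rho x}.indicator (fun _ : E => (1:ℝ)) x := by
        by_cases h2 : (N:ℝ) ≤ rho x
        · rw [indicator_of_mem (by exact h2), mul_one]
          have := cut_fderiv_le hL (-1) (N + 1 : ℝ) x
          rw [abs_neg, abs_one, mul_one] at this
          have h5 : ‖fderiv ℝ b x‖ ^ 2 ≤ L ^ 2 := by gcongr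
          exact sq_mul_le a0 a1 (sq_nonneg _) h5
        · have : ‖fderiv ℝ b x‖ = 0 := cut_fderiv_zero (Or.inr (by push Not at h2; linarith))
          rw [indicator_of_notMem (by exact h2), this]; simp
      have t2 : b x ^ 2 * ‖fderiv ℝ a x‖ ^ 2 ≤
          (L / δ) ^ 2 * {x : E | s ≤ rho x}.indicator (fun _ : E => (1:ℝ)) x := by
        by_cases h2 : s ≤ rho x
        · rw [indicator_of_mem (by exact h2), mul_one]
          have := cut_fderiv_le hL (δ⁻¹) (-(s / δ)) x
          rw [abs_of_pos (by positivity : 0 < δ⁻¹), ← div_eq_mul_inv] at this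
          have h5 : ‖fderiv ℝ a x‖ ^ 2 ≤ (L / δ) ^ 2 := by gcongr
          exact sq_mul_le b0 b1 (sq_nonneg _) h5
        · have : ‖fderiv ℝ a x‖ = 0 := cut_fderiv_zero (Or.inl (by
            rw [ea]; push Not at h2
            exact div_nonpos_of_nonpos_of_nonneg (by linarith) hδ.le))
          rw [indicator_of_notMem (by exact h2), this]; simp
      linarith
    have l3 : ∫ x, |a x * b x| ∂μ ≤ tail μ s := by
      rw [← indv]
      apply integral_mono (int_cs hcd.continuous hcs).abs (ind _)
      intro x
      show |a x * b x| ≤ _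
      have a0 : 0 ≤ a x := cut_nonneg _ _ _
      have a1 : a x ≤ 1 := cut_le_one _ _ _
      have b0 : 0 ≤ b x := cut_nonneg _ _ _
      have b1 : b x ≤ 1 := cut_le_one _ _ _
      rw [abs_of_nonneg (by positivity)]
      by_cases h2 : s ≤ rho x
      · rw [indicator_of_mem (by exact h2)]; exact mul_le_one₀ a1 b0 b1
      · rw [indicator_of_notMem (by exact h2), hA x h2]; simp
    have l4 : 0 ≤ ∫ x, |a x * b x| ∂μ := integral_nonneg fun x => abs_nonneg _
    calc _ ≤ _ := l1
      _ ≤ _ := h1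
      _ ≤ _ := by gcongr
  have ht := tail_tendsto μ
  have t1 : Filter.Tendsto (fun N : ℕ => tail μ (s + δ) - tail μ N) Filter.atTop
      (nhds (tail μ (s + δ) - 0)) := tendsto_const_nhds.sub ht
  have t2 : Filter.Tendsto (fun N : ℕ => (q ^ 2)⁻¹ * (2 * (L / δ) ^ 2 * tail μ s + 2 * L ^ 2 * tail μ N)
      + Real.exp (c * (1 + q)) * tail μ s ^ 2) Filter.atTop
      (nhds ((q ^ 2)⁻¹ * (2 * (L / δ) ^ 2 * tail μ s + 2 * L ^ 2 * 0)
      + Real.exp (c * (1 + q)) * tail μ s ^ 2)) :=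
    ((tendsto_const_nhds.add (ht.const_mul _)).const_mul _).add tendsto_const_nhds
  have := le_of_tendsto_of_tendsto' t1 t2 main
  simpa using this

lemma tail_step {μ : Measure E} [IsProbabilityMeasure μ] {c : ℝ} (hc : 0 < c) (hSP : SPI μ c) :
    ∃ K > (0:ℝ), ∀ m : ℝ, 2 * c + 6 ≤ m → ∀ s, tail μ s ≤ Real.exp (-m) →
      tail μ (s + K / m) ≤ Real.exp (-1) * tail μ s := by
  obtain ⟨L, hL1, hL⟩ := T_deriv_bdd
  refine ⟨8 * c * L, by positivity, fun m hm s hs => ?_⟩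
  have hm0 : 0 < m := by linarith
  set δ := 8 * c * L / m with hδ
  have hδ0 : 0 < δ := by positivity
  have h := tail_step0 hSP hL (q := 4 * L / δ) (by positivity) hδ0 s
  have e1 : ((4 * L / δ) ^ 2)⁻¹ * (2 * (L / δ) ^ 2 * tail μ s) = 1 / 8 * tail μ s := by
    field_simp; ring
  have e2 : c * (1 + 4 * L / δ) = c + m / 2 := by
    rw [hδ]; field_simp; ring
  rw [e1, e2] at h
  have hex3 : Real.exp (-3) ≤ 1 / 8 := by
    have h1 : Real.exp (-3) = (Real.exp 1 ^ 3)⁻¹ := by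
      rw [← Real.exp_nat_mul, ← Real.exp_neg]; norm_num
    rw [h1, one_div]
    apply inv_anti₀ (by norm_num)
    have := Real.exp_one_gt_d9
    have h2 : (2:ℝ) ≤ Real.exp 1 := by linarith
    calc (8:ℝ) = 2 ^ 3 := by norm_num
      _ ≤ _ := by gcongr
  have hex1 : 1 / 4 ≤ Real.exp (-1) := by
    rw [Real.exp_neg, one_div]
    apply inv_anti₀ (by positivity)
    have := Real.exp_one_lt_d9
    linarith
  have h0 := tail_nonneg μ s
  have h3 : Real.exp (c + m / 2) * tail μ s ≤ 1 / 8 := by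
    calc _ ≤ Real.exp (c + m / 2) * Real.exp (-m) := by gcongr
      _ = Real.exp (c + m / 2 + -m) := (Real.exp_add _ _).symm
      _ ≤ Real.exp (-3) := by apply Real.exp_le_exp.2; linarith
      _ ≤ _ := hex3
  nlinarith

lemma tail_double {μ : Measure E} [IsProbabilityMeasure μ] {c : ℝ} (hc : 0 < c) (hSP : SPI μ c) :
    ∃ K > (0:ℝ), ∃ m0 : ℕ, 0 < m0 ∧ ∃ s0 : ℝ, ∀ j : ℕ,
      tail μ (s0 + j * K) ≤ Real.exp (-(2 ^ j * m0)) := by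
  obtain ⟨K, hK, hstep⟩ := tail_step hc hSP
  obtain ⟨m0, hm0⟩ := exists_nat_ge (2 * c + 6)
  have hm0' : 0 < (m0:ℝ) := by linarith
  have hev := (tail_tendsto μ).eventually (gt_mem_nhds (Real.exp_pos (-(m0:ℝ))))
  obtain ⟨n, hn⟩ := hev.exists
  refine ⟨K, hK, m0, by exact_mod_cast hm0', n, fun j => ?_⟩
  have dbl : ∀ m : ℕ, m0 ≤ m → ∀ s, tail μ s ≤ Real.exp (-m) → tail μ (s + K) ≤ Real.exp (-(2 * m)) := by
    intro m hm s hs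
    have hmr : (m0:ℝ) ≤ m := by exact_mod_cast hm
    have hmp : (0:ℝ) < m := by linarith
    have it : ∀ i : ℕ, tail μ (s + i * (K / m)) ≤ Real.exp (-(m + i)) := by
      intro i
      induction i with
      | zero => simpa using hs
      | succ i ih =>
        have h1 : tail μ (s + i * (K / m)) ≤ Real.exp (-m) := by
          refine ih.trans (Real.exp_le_exp.2 ?_)
          have : (0:ℝ) ≤ i := by positivity
          linarith
        have h2 := hstep m (by linarith) _ h1
        have e : s + i * (K / m) + K / m = s + ((i + 1 : ℕ) : ℝ) * (K / m) := by push_cast; ring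
        rw [e] at h2
        refine h2.trans ?_
        calc _ ≤ Real.exp (-1) * Real.exp (-(m + i)) := by gcongr
          _ = _ := by rw [← Real.exp_add]; push_cast; ring_nf
    have := it m
    have e : s + m * (K / m) = s + K := by field_simp
    rw [e] at this
    convert this using 2; ring
  induction j with
  | zero => simpa using hn.le
  | succ j ih =>
    have h1 := dbl (2 ^ j * m0) (Nat.le_mul_of_pos_left _ (by positivity)) (n + j * K) (by push_cast; exact ih)
    have e : (n:ℝ) + ((j + 1 : ℕ) : ℝ) * K = n + j * K + K := by push_cast; ring
    rw [e]
    refine h1.trans (le_of_eq ?_)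
    push_cast
    ring_nf

lemma tail_exp {μ : Measure E} [IsProbabilityMeasure μ] {c : ℝ} (hc : 0 < c) (hSP : SPI μ c) :
    ∃ a > (0:ℝ), ∃ δ > (0:ℝ), ∃ s0 : ℝ, ∀ s ≥ s0,
      tail μ s ≤ Real.exp (-(δ * Real.exp (a * s))) := by
  obtain ⟨K, hK, m0, hm0, s0, h⟩ := tail_double hc hSP
  have hm0' : (0:ℝ) < m0 := by exact_mod_cast hm0
  have hl2 : 0 < Real.log 2 := Real.log_pos (by norm_num)
  refine ⟨Real.log 2 / K, by positivity, m0 / 2 * Real.exp (-(Real.log 2 / K * s0)), by positivity, s0,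
    fun s hs => ?_⟩
  set y := (s - s0) / K with hy
  have hy0 : 0 ≤ y := div_nonneg (by linarith) hK.le
  have h1 := h ⌊y⌋₊
  have h2 : s0 + ⌊y⌋₊ * K ≤ s := by
    have := Nat.floor_le hy0
    have : ⌊y⌋₊ * K ≤ y * K := by gcongr
    have e : y * K = s - s0 := by rw [hy]; field_simp
    linarith
  refine (tail_anti μ h2).trans (h1.trans ?_)
  apply Real.exp_le_exp.2
  apply neg_le_neg
  have e1 : m0 / 2 * Real.exp (-(Real.log 2 / K * s0)) * Real.exp (Real.log 2 / K * s)
      = m0 / 2 * Real.exp (Real.log 2 * y) := by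
    rw [mul_assoc, ← Real.exp_add]
    congr 2
    rw [hy]; field_simp; ring
  rw [e1]
  have h3 : Real.exp (Real.log 2 * y) ≤ 2 ^ ⌊y⌋₊ * 2 := by
    have : Real.log 2 * y ≤ Real.log 2 * ((⌊y⌋₊ + 1 : ℕ) : ℝ) := by
      have := (Nat.lt_floor_add_one y).le
      push_cast
      gcongr
    calc _ ≤ Real.exp (Real.log 2 * ((⌊y⌋₊ + 1 : ℕ) : ℝ)) := Real.exp_le_exp.2 this
      _ = _ := by
        rw [mul_comm, Real.exp_nat_mul, Real.exp_log (by norm_num), pow_succ]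
  nlinarith

end

section
variable {d : ℕ}
local notation "E" => EuclideanSpace ℝ (Fin d)

/-- thick annulus -/
def ann (d n : ℕ) : Set (EuclideanSpace ℝ (Fin d)) := {x | (n:ℝ) - 1 ≤ rho x ∧ rho x ≤ n + 2}
/-- thin annulus -/
def sann (d n : ℕ) : Set (EuclideanSpace ℝ (Fin d)) := {x | (n:ℝ) ≤ rho x ∧ rho x < n + 1}

lemma rho_meas : Measurable (rho (d := d)) := rho_cd.continuous.measurable

lemma ann_meas (n : ℕ) : MeasurableSet (ann d n) :=
  (measurableSet_le measurable_const rho_meas).inter (measurableSet_le rho_meas measurable_const)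
lemma sann_meas (n : ℕ) : MeasurableSet (sann d n) :=
  (measurableSet_le measurable_const rho_meas).inter (measurableSet_lt rho_meas measurable_const)

lemma int_on_ball {μ : Measure E} [IsProbabilityMeasure μ] {f : E → ℝ} (hf : Continuous f) (R : ℝ) :
    IntegrableOn f {x | rho x ≤ R} μ := by
  have h : IntegrableOn f (Metric.closedBall (0:E) R) μ :=
    hf.continuousOn.integrableOn_compact (isCompact_closedBall _ _)
  apply h.mono_set
  intro x hx
  rw [Metric.mem_closedBall, dist_zero_right]
  exact (norm_le_rho x).trans hx

lemma int_ann {μ : Measure E} [IsProbabilityMeasure μ] {f : E → ℝ} (hf : Continuous f) (n : ℕ) :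
    IntegrableOn f (ann d n) μ := (int_on_ball hf (n + 2)).mono_set fun _ hx => hx.2
lemma int_sann {μ : Measure E} [IsProbabilityMeasure μ] {f : E → ℝ} (hf : Continuous f) (n : ℕ) :
    IntegrableOn f (sann d n) μ := (int_on_ball hf (n + 1)).mono_set fun _ hx => hx.2.le

lemma annulus {μ : Measure E} [IsProbabilityMeasure μ] {c : ℝ} (hc : 0 < c) (hSP : SPI μ c) :
    ∃ a > (0:ℝ), ∃ C > (0:ℝ), ∃ n0 : ℕ, ∀ n ≥ n0, ∀ f : E → ℝ, ContDiff ℝ (⊤ : ℕ∞) f →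
      ∫ x in sann d n, f x ^ 2 ∂μ ≤
        C * Real.exp (-(2 * a * n)) * ∫ x in ann d n, (‖fderiv ℝ f x‖ ^ 2 + f x ^ 2) ∂μ := by
  obtain ⟨L, hL1, hL⟩ := T_deriv_bdd
  obtain ⟨a, ha, δ, hδ, s0, htail⟩ := tail_exp hc hSP
  set δ' := δ * Real.exp (-a) with hδ'
  have hδp : 0 < δ' := by positivity
  set k := δ' / (2 * c) with hk
  have hkp : 0 < k := by positivity
  obtain ⟨n1, hn1⟩ := exists_nat_ge (s0 + 1)
  obtain ⟨n2, hn2⟩ := exists_nat_ge (2 * (c + 1) / (δ' * a))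
  refine ⟨a, ha, 16 * L ^ 2 * (k ^ 2)⁻¹, by positivity, max n1 n2, fun n hn f hf => ?_⟩
  have hn1' : s0 + 1 ≤ n := hn1.trans (by exact_mod_cast (le_max_left _ _).trans hn)
  have hn2' : 2 * (c + 1) / (δ' * a) ≤ n := hn2.trans (by exact_mod_cast (le_max_right _ _).trans hn)
  have hbig : 2 * (c + 1) ≤ δ' * Real.exp (a * n) := by
    rw [div_le_iff₀ (by positivity)] at hn2'
    have := Real.add_one_le_exp (a * n)
    nlinarith
  set u : E → ℝ := cut 1 (-n + 1) with hu
  set v : E → ℝ := cut (-1) (n + 2) with hv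
  set h : E → ℝ := fun x => u x * v x with hh
  have hhcd : ContDiff ℝ (⊤ : ℕ∞) h := (cut_cd _ _).mul (cut_cd _ _)
  have u0 : ∀ x, 0 ≤ u x := cut_nonneg _ _
  have u1 : ∀ x, u x ≤ 1 := cut_le_one _ _
  have v0 : ∀ x, 0 ≤ v x := cut_nonneg _ _
  have v1 : ∀ x, v x ≤ 1 := cut_le_one _ _
  have h00 : ∀ x, 0 ≤ h x := fun x => mul_nonneg (u0 x) (v0 x)
  have h01 : ∀ x, h x ≤ 1 := fun x => mul_le_one₀ (u1 x) (v0 x) (v1 x)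
  have hd : ∀ x, ‖fderiv ℝ h x‖ ^ 2 ≤ 4 * L ^ 2 := by
    intro x
    refine (fderiv_mul_sq (cut_cd _ _) (cut_cd _ _) x).trans ?_
    have e1 := cut_fderiv_le hL 1 (-n + 1) x
    have e2 := cut_fderiv_le hL (-1) (n + 2) x
    rw [abs_one, mul_one] at e1
    rw [abs_neg, abs_one, mul_one] at e2
    have e3 := sq_mul_le (u0 x) (u1 x) (sq_nonneg _) (pow_le_pow_left₀ (norm_nonneg _) e2 2)
    have e4 := sq_mul_le (v0 x) (v1 x) (sq_nonneg _) (pow_le_pow_left₀ (norm_nonneg _) e1 2)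
    linarith
  have hzero : ∀ x, x ∉ ann d n → h x = 0 ∧ ‖fderiv ℝ h x‖ ^ 2 = 0 := by
    intro x hx
    have hn0 : 0 ≤ ‖fderiv ℝ h x‖ ^ 2 := sq_nonneg _
    have hle := fderiv_mul_sq (d := d) (cut_cd 1 (-n + 1)) (cut_cd (-1) (n + 2)) x
    have hx' : rho x < n - 1 ∨ (n:ℝ) + 2 < rho x := by
      by_contra hcon
      push Not at hcon
      exact hx ⟨hcon.1, hcon.2⟩
    rcases hx' with hx' | hx'
    · have e1 : u x = 0 := cut_zero (by linarith)
      have e2 : ‖fderiv ℝ u x‖ = 0 := cut_fderiv_zero (Or.inl (by linarith))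
      refine ⟨by simp [hh, e1], le_antisymm (hle.trans (le_of_eq ?_)) hn0⟩
      rw [show cut 1 (-n + 1) x = 0 from e1, e2]; simp
    · have e1 : v x = 0 := cut_zero (by linarith)
      have e2 : ‖fderiv ℝ v x‖ = 0 := cut_fderiv_zero (Or.inl (by linarith))
      refine ⟨by simp [hh, e1], le_antisymm (hle.trans (le_of_eq ?_)) hn0⟩
      rw [show cut (-1) (n + 2) x = 0 from e1, e2]; simp
  have hone : ∀ x ∈ sann d n, h x = 1 := by
    intro x hx
    have e1 : u x = 1 := cut_one (by linarith [hx.1])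
    have e2 : v x = 1 := cut_one (by linarith [hx.2])
    simp [hh, e1, e2]
  have gcd : ContDiff ℝ (⊤ : ℕ∞) (fun x => f x * h x) := hf.mul hhcd
  have gcs : HasCompactSupport (fun x => f x * h x) := by
    apply hcs_of_rho (R := n + 3)
    intro x hx
    rw [(hzero x (fun hx' => by linarith [hx'.2])).1, mul_zero]
  have hq0 : 0 < k * Real.exp (a * n) := by positivity
  have hcond : Real.exp (c * (1 + k * Real.exp (a * n))) * μ.real {x : E | (n:ℝ) - 1 ≤ rho x} ≤ 1 / 2 := by
    have ht : μ.real {x : E | (n:ℝ) - 1 ≤ rho x} ≤ Real.exp (-(δ * Real.exp (a * (n - 1)))) :=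
      htail _ (by linarith)
    have e1 : δ * Real.exp (a * (n - 1)) = δ' * Real.exp (a * n) := by
      rw [hδ', mul_assoc, ← Real.exp_add]; ring_nf
    have e2 : c * (1 + k * Real.exp (a * n)) = c + δ' * Real.exp (a * n) / 2 := by
      rw [hk]; field_simp
    rw [e1] at ht
    rw [e2]
    calc _ ≤ Real.exp (c + δ' * Real.exp (a * n) / 2) * Real.exp (-(δ' * Real.exp (a * n))) := by gcongr
      _ = Real.exp (c + δ' * Real.exp (a * n) / 2 + -(δ' * Real.exp (a * n))) := (Real.exp_add _ _).symm
      _ ≤ Real.exp (-1) := by apply Real.exp_le_exp.2; linarith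
      _ ≤ 1 / 2 := by
        rw [Real.exp_neg, one_div]
        apply inv_anti₀ (by positivity)
        have := Real.exp_one_gt_d9
        linarith
  have hkey := key_SP hSP hq0 gcd gcs (rho_ge_meas _) (fun x hx => by
    rw [(hzero x (fun hx' => hx hx'.1)).1, mul_zero]) hcond
  have fc := hf.continuous
  have l1 : ∫ x in sann d n, f x ^ 2 ∂μ ≤ ∫ x, (f x * h x) ^ 2 ∂μ := by
    have i2 : Integrable (fun x => (f x * h x) ^ 2) μ :=
      int_cs (gcd.continuous.pow 2) (gcs.comp_left (g := fun t : ℝ => t ^ 2) (by simp))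
    calc _ = ∫ x in sann d n, (f x * h x) ^ 2 ∂μ := by
            apply setIntegral_congr_fun (sann_meas n)
            intro x hx
            simp [hone x hx]
      _ ≤ _ := setIntegral_le_integral i2 (Filter.Eventually.of_forall fun x => sq_nonneg _)
  have l2 : ∫ x, ‖fderiv ℝ (fun x => f x * h x) x‖ ^ 2 ∂μ ≤
      8 * L ^ 2 * ∫ x in ann d n, (‖fderiv ℝ f x‖ ^ 2 + f x ^ 2) ∂μ := by
    rw [← integral_const_mul, ← integral_indicator (ann_meas n)]
    apply integral_mono_of_nonneg (Filter.Eventually.of_forall fun x => sq_nonneg _)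
    · apply IntegrableOn.integrable_indicator _ (ann_meas n)
      exact int_ann (((cd_norm_cont hf).add (fc.pow 2)).const_mul _) n
    refine Filter.Eventually.of_forall fun x => ?_
    refine (fderiv_mul_sq hf hhcd x).trans ?_
    by_cases hx : x ∈ ann d n
    · rw [indicator_of_mem hx]
      have e1 : f x ^ 2 * ‖fderiv ℝ h x‖ ^ 2 ≤ f x ^ 2 * (4 * L ^ 2) := by
        gcongr; exact hd x
      have e2 := sq_mul_le (h00 x) (h01 x) (sq_nonneg ‖fderiv ℝ f x‖) le_rfl
      have : 1 ≤ L ^ 2 := one_le_pow₀ hL1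
      nlinarith [sq_nonneg ‖fderiv ℝ f x‖, sq_nonneg (f x)]
    · rw [indicator_of_notMem hx, (hzero x hx).1, (hzero x hx).2]; simp
  have l3 : 0 ≤ 2 * ((k * Real.exp (a * n)) ^ 2)⁻¹ := by positivity
  refine l1.trans (hkey.trans ((mul_le_mul_of_nonneg_left l2 l3).trans (le_of_eq ?_)))
  have e3 : Real.exp (-(2 * a * n)) = (Real.exp (a * n) ^ 2)⁻¹ := by
    rw [← Real.exp_nat_mul, ← Real.exp_neg]; push_cast; ring_nf
  rw [e3, mul_pow, mul_inv]; ring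

lemma ann_count (x : E) (s : Finset ℕ) :
    ∑ n ∈ s, (ann d n).indicator (fun _ => (1:ℝ)) x ≤ 4 := by
  classical
  have h1 : ∑ n ∈ s, (ann d n).indicator (fun _ => (1:ℝ)) x
      = ∑ n ∈ s with x ∈ ann d n, (1:ℝ) := by
    rw [Finset.sum_filter]
    apply Finset.sum_congr rfl
    intro n _
    by_cases h : x ∈ ann d n <;> simp [h]
  rw [h1, Finset.sum_const, nsmul_eq_mul, mul_one]
  have hsub : (s.filter fun n => x ∈ ann d n) ⊆ Finset.Icc (⌊rho x⌋₊ - 2) (⌊rho x⌋₊ + 1) := by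
    intro n hn
    obtain ⟨h1, h2⟩ := (Finset.mem_filter.1 hn).2
    have h0 : 0 ≤ rho x := by linarith [one_le_rho x]
    rw [Finset.mem_Icc]
    constructor
    · have : (⌊rho x⌋₊ : ℝ) ≤ n + 2 := (Nat.floor_le h0).trans h2
      have : ⌊rho x⌋₊ ≤ n + 2 := by exact_mod_cast this
      omega
    · have : (n:ℝ) < ⌊rho x⌋₊ + 1 + 1 := by linarith [Nat.lt_floor_add_one (rho x)]
      have : n < ⌊rho x⌋₊ + 1 + 1 := by exact_mod_cast this
      omega
  have := Finset.card_le_card hsub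
  rw [Nat.card_Icc] at this
  have h4 : (s.filter fun n => x ∈ ann d n).card ≤ 4 := by omega
  exact_mod_cast h4

lemma ann_sum {μ : Measure E} [IsProbabilityMeasure μ] {w : E → ℝ} (hw0 : ∀ x, 0 ≤ w x)
    (hw : Integrable w μ) (n0 N : ℕ) :
    ∑ n ∈ Finset.Ico n0 N, ∫ x in ann d n, w x ∂μ ≤ 4 * ∫ x in {x | (n0:ℝ) - 1 ≤ rho x}, w x ∂μ := by
  have e1 : ∀ n, ∫ x in ann d n, w x ∂μ = ∫ x, (ann d n).indicator w x ∂μ := fun n =>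
    (integral_indicator (ann_meas n)).symm
  simp_rw [e1]
  rw [← integral_finsetSum _ (fun n _ => hw.indicator (ann_meas n)), ← integral_const_mul,
    ← integral_indicator (rho_ge_meas _)]
  apply integral_mono (integrable_finsetSum _ (fun n _ => hw.indicator (ann_meas n)))
    ((hw.const_mul 4).indicator (rho_ge_meas _))
  intro x
  show ∑ n ∈ Finset.Ico n0 N, (ann d n).indicator w x ≤ {x : E | (n0:ℝ) - 1 ≤ rho x}.indicator (fun x => 4 * w x) x
  by_cases hx : (n0:ℝ) - 1 ≤ rho x
  · rw [indicator_of_mem (by exact hx)]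
    have e2 : ∀ n, (ann d n).indicator w x = (ann d n).indicator (fun _ => (1:ℝ)) x * w x := by
      intro n; by_cases h : x ∈ ann d n <;> simp [h]
    simp_rw [e2]
    rw [← Finset.sum_mul]
    exact mul_le_mul_of_nonneg_right (ann_count x _) (hw0 x)
  · rw [indicator_of_notMem (by exact hx)]
    apply le_of_eq
    apply Finset.sum_eq_zero
    intro n hn
    apply indicator_of_notMem
    intro h
    have h1 := h.1
    have : (n0:ℝ) ≤ n := by exact_mod_cast (Finset.mem_Ico.1 hn).1
    linarith

lemma sann_sum {μ : Measure E} [IsProbabilityMeasure μ] {w : E → ℝ} (hw0 : ∀ x, 0 ≤ w x)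
    (hw : Continuous w) (n0 N : ℕ) :
    ∫ x in {x | (n0:ℝ) ≤ rho x ∧ rho x < N}, w x ∂μ ≤ ∑ n ∈ Finset.Ico n0 N, ∫ x in sann d n, w x ∂μ := by
  have hm : MeasurableSet {x : E | (n0:ℝ) ≤ rho x ∧ rho x < N} :=
    (measurableSet_le measurable_const rho_meas).inter (measurableSet_lt rho_meas measurable_const)
  have e1 : ∀ n, ∫ x in sann d n, w x ∂μ = ∫ x, (sann d n).indicator w x ∂μ := fun n =>
    (integral_indicator (sann_meas n)).symm
  have i1 : ∀ n, Integrable ((sann d n).indicator w) μ := fun n =>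
    (int_sann hw n).integrable_indicator (sann_meas n)
  simp_rw [e1]
  rw [← integral_finsetSum _ (fun n _ => i1 n), ← integral_indicator hm]
  apply integral_mono
    (((int_on_ball hw N).mono_set fun x hx => hx.2.le).integrable_indicator hm)
    (integrable_finsetSum _ (fun n _ => i1 n))
  intro x
  show {x : E | (n0:ℝ) ≤ rho x ∧ rho x < N}.indicator w x ≤ ∑ n ∈ Finset.Ico n0 N, (sann d n).indicator w x
  have hnn : ∀ n ∈ Finset.Ico n0 N, 0 ≤ (sann d n).indicator w x :=
    fun n _ => indicator_nonneg (fun x _ => hw0 x) x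
  by_cases hx : (n0:ℝ) ≤ rho x ∧ rho x < N
  · have h0 : 0 ≤ rho x := by linarith [one_le_rho x]
    rw [indicator_of_mem (by exact hx)]
    have hmem : ⌊rho x⌋₊ ∈ Finset.Ico n0 N := by
      rw [Finset.mem_Ico]
      exact ⟨Nat.le_floor hx.1, (Nat.floor_lt h0).2 hx.2⟩
    have := Finset.single_le_sum hnn hmem
    rwa [indicator_of_mem (show x ∈ sann d ⌊rho x⌋₊ from ⟨Nat.floor_le h0, Nat.lt_floor_add_one _⟩)] at this
  · rw [indicator_of_notMem (by exact hx)]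
    exact Finset.sum_nonneg hnn

end

section
variable {d : ℕ}
local notation "E" => EuclideanSpace ℝ (Fin d)

def AnnIneq (μ : Measure (EuclideanSpace ℝ (Fin d))) (a C : ℝ) (n0 : ℕ) : Prop :=
  ∀ n ≥ n0, ∀ f : EuclideanSpace ℝ (Fin d) → ℝ, ContDiff ℝ (⊤ : ℕ∞) f →
      ∫ x in sann d n, f x ^ 2 ∂μ ≤
        C * Real.exp (-(2 * a * n)) * ∫ x in ann d n, (‖fderiv ℝ f x‖ ^ 2 + f x ^ 2) ∂μ

lemma exp_int {μ : Measure E} [IsProbabilityMeasure μ] {g : E → ℝ} (hg : Integrable g μ)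
    {l : ℝ} (hl : 0 ≤ l) : Integrable (fun x => Real.exp (-(l * rho x)) * g x) μ := by
  have hc : Continuous fun x : E => Real.exp (-(l * rho x)) := by
    have := (rho_cd (d := d)).continuous
    fun_prop
  apply hg.bdd_mul (c := 1) hc.aestronglyMeasurable
  refine Filter.Eventually.of_forall fun x => ?_
  rw [Real.norm_eq_abs, abs_of_pos (Real.exp_pos _)]
  apply Real.exp_le_one_iff.2
  have := one_le_rho x
  have : 0 ≤ l * rho x := by positivity
  linarith

lemma weighted_sum {μ : Measure E} [IsProbabilityMeasure μ] {a C : ℝ} (hC : 0 < C)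
    {n0 : ℕ} (h : AnnIneq μ a C n0) {t : ℝ} (ht0 : 0 ≤ t) (ht : t ≤ 2 * a) {n1 : ℕ} (hn : n0 ≤ n1)
    (N : ℕ) {f : E → ℝ} (hf : ContDiff ℝ (⊤ : ℕ∞) f)
    (hi : Integrable (fun x => ‖fderiv ℝ f x‖ ^ 2 + f x ^ 2) μ) :
    ∫ x in {x | (n1:ℝ) ≤ rho x ∧ rho x < N}, Real.exp (t * rho x) * f x ^ 2 ∂μ ≤
      4 * C * Real.exp (t + 2 * (2 * a - t)) *
        ∫ x in {x | (n1:ℝ) - 1 ≤ rho x}, Real.exp (-((2 * a - t) * rho x)) *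
          (‖fderiv ℝ f x‖ ^ 2 + f x ^ 2) ∂μ := by
  have rc := (rho_cd (d := d)).continuous
  have fc := hf.continuous
  set l := 2 * a - t with hl
  have hl0 : 0 ≤ l := by linarith
  have s1 := sann_sum (μ := μ) (w := fun x => Real.exp (t * rho x) * f x ^ 2) (fun x => by positivity)
    (by fun_prop) n1 N
  have s2 := ann_sum (μ := μ) (w := fun x => Real.exp (-(l * rho x)) * (‖fderiv ℝ f x‖ ^ 2 + f x ^ 2))
    (fun x => by positivity) (exp_int hi hl0) n1 N
  have s3 : ∀ n ∈ Finset.Ico n1 N, ∫ x in sann d n, Real.exp (t * rho x) * f x ^ 2 ∂μ ≤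
      C * Real.exp (t + 2 * l) *
      ∫ x in ann d n, Real.exp (-(l * rho x)) * (‖fderiv ℝ f x‖ ^ 2 + f x ^ 2) ∂μ := by
    intro n hn'
    have hnn : n0 ≤ n := hn.trans (Finset.mem_Ico.1 hn').1
    have a1 : ∫ x in sann d n, Real.exp (t * rho x) * f x ^ 2 ∂μ ≤
        Real.exp (t * (n + 1)) * ∫ x in sann d n, f x ^ 2 ∂μ := by
      rw [← integral_const_mul]
      apply setIntegral_mono_on (int_sann (by fun_prop) n) (int_sann (by fun_prop) n) (sann_meas n)
      intro x hx
      have := hx.2.le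
      gcongr
    have a2 : Real.exp (-(l * (n + 2))) * ∫ x in ann d n, (‖fderiv ℝ f x‖ ^ 2 + f x ^ 2) ∂μ ≤
        ∫ x in ann d n, Real.exp (-(l * rho x)) * (‖fderiv ℝ f x‖ ^ 2 + f x ^ 2) ∂μ := by
      rw [← integral_const_mul]
      apply setIntegral_mono_on (hi.const_mul _).integrableOn (exp_int hi hl0).integrableOn (ann_meas n)
      intro x hx
      have := hx.2
      gcongr
    have a3 := h n hnn f hf
    calc _ ≤ _ := a1
      _ ≤ Real.exp (t * (n + 1)) * (C * Real.exp (-(2 * a * n)) *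
            ∫ x in ann d n, (‖fderiv ℝ f x‖ ^ 2 + f x ^ 2) ∂μ) := by gcongr
      _ = C * Real.exp (t + 2 * l) * (Real.exp (-(l * (n + 2))) *
            ∫ x in ann d n, (‖fderiv ℝ f x‖ ^ 2 + f x ^ 2) ∂μ) := by
        have : Real.exp (t * (n + 1)) * Real.exp (-(2 * a * n))
            = Real.exp (t + 2 * l) * Real.exp (-(l * (n + 2))) := by
          rw [← Real.exp_add, ← Real.exp_add, hl]; ring_nf
        linear_combination (C * ∫ x in ann d n, (‖fderiv ℝ f x‖ ^ 2 + f x ^ 2) ∂μ) * this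
      _ ≤ _ := by gcongr
  refine s1.trans ((Finset.sum_le_sum s3).trans ?_)
  rw [← Finset.mul_sum]
  have hp : 0 ≤ C * Real.exp (t + 2 * l) := by positivity
  refine (mul_le_mul_of_nonneg_left s2 hp).trans (le_of_eq ?_)
  ring

lemma cs_bdd {f : E → ℝ} (hs : HasCompactSupport f) : ∃ N : ℕ, ∀ x, (N:ℝ) ≤ rho x → f x = 0 := by
  obtain ⟨R, hR⟩ := hs.isCompact.isBounded.subset_closedBall 0
  obtain ⟨N, hN⟩ := exists_nat_gt (1 + |R|)
  refine ⟨N, fun x hx => ?_⟩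
  by_contra hne
  have := hR (subset_tsupport _ hne)
  rw [Metric.mem_closedBall, dist_zero_right] at this
  have h2 : rho x ≤ 1 + ‖x‖ := by
    apply Real.sqrt_le_iff.2 ⟨by positivity, ?_⟩
    nlinarith [norm_nonneg x]
  linarith [le_abs_self R]

lemma cs_grad_int {μ : Measure E} [IsProbabilityMeasure μ] {f : E → ℝ} (hf : ContDiff ℝ (⊤ : ℕ∞) f)
    (hs : HasCompactSupport f) : Integrable (fun x => ‖fderiv ℝ f x‖ ^ 2) μ :=
  int_cs (cd_norm_cont hf) ((hs.fderiv ℝ).comp_left (g := fun t : E →L[ℝ] ℝ => ‖t‖ ^ 2) (by simp))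

lemma cs_sq_int {μ : Measure E} [IsProbabilityMeasure μ] {f : E → ℝ} (hf : Continuous f)
    (hs : HasCompactSupport f) : Integrable (fun x => f x ^ 2) μ :=
  int_cs (hf.pow 2) (hs.comp_left (g := fun t : ℝ => t ^ 2) (by simp))

lemma hardy {μ : Measure E} [IsProbabilityMeasure μ] {a C : ℝ} (ha : 0 < a) (hC : 0 < C)
    {n0 : ℕ} (h : AnnIneq μ a C n0) : ∃ K > (0:ℝ), ∀ f : E → ℝ, ContDiff ℝ (⊤ : ℕ∞) f →
      HasCompactSupport f → ∫ x, Real.exp (a * rho x) * f x ^ 2 ∂μ ≤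
        K * (∫ x, Real.exp (-(a * rho x)) * ‖fderiv ℝ f x‖ ^ 2 ∂μ + ∫ x, f x ^ 2 ∂μ) := by
  have rc := (rho_cd (d := d)).continuous
  refine ⟨4 * C * Real.exp (a + 2 * (2 * a - a)) + Real.exp (a * n0), by positivity, fun f hf hs => ?_⟩
  set K1 := 4 * C * Real.exp (a + 2 * (2 * a - a)) with hK1
  have K1p : 0 < K1 := by positivity
  have fc := hf.continuous
  obtain ⟨N, hN⟩ := cs_bdd hs
  have i1 := cs_grad_int (μ := μ) hf hs
  have i2 := cs_sq_int (μ := μ) hf.continuous hs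
  have i3 := exp_int i1 ha.le
  have i4 := exp_int i2 ha.le
  have hw := weighted_sum hC h ha.le (by linarith) le_rfl N hf (i1.add i2)
  rw [show 2 * a - a = a by ring] at hw hK1
  rw [← hK1] at hw
  have i5 : Integrable (fun x => Real.exp (a * rho x) * f x ^ 2) μ :=
    int_cs (by fun_prop) ((hs.comp_left (g := fun t : ℝ => t ^ 2) (by simp)).mul_left)
  have hm : MeasurableSet {x : E | (n0:ℝ) ≤ rho x} := rho_ge_meas _
  have b1 : ∫ x in {x : E | (n0:ℝ) ≤ rho x}, Real.exp (a * rho x) * f x ^ 2 ∂μ =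
      ∫ x in {x | (n0:ℝ) ≤ rho x ∧ rho x < N}, Real.exp (a * rho x) * f x ^ 2 ∂μ := by
    apply setIntegral_eq_of_subset_of_forall_sdiff_eq_zero hm (fun x hx => hx.1)
    intro x hx
    have : (N:ℝ) ≤ rho x := by
      by_contra hcon
      push Not at hcon
      exact hx.2 ⟨hx.1, hcon⟩
    simp [hN x this]
  have b2 : ∫ x in {x : E | (n0:ℝ) ≤ rho x}ᶜ, Real.exp (a * rho x) * f x ^ 2 ∂μ ≤
      Real.exp (a * n0) * ∫ x, f x ^ 2 ∂μ := by
    calc _ ≤ ∫ x in {x : E | (n0:ℝ) ≤ rho x}ᶜ, Real.exp (a * n0) * f x ^ 2 ∂μ := by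
            apply setIntegral_mono_on i5.integrableOn (i2.const_mul _).integrableOn hm.compl
            intro x hx
            have : rho x ≤ n0 := by
              by_contra hcon
              push Not at hcon
              exact hx hcon.le
            gcongr
      _ ≤ ∫ x, Real.exp (a * n0) * f x ^ 2 ∂μ :=
            setIntegral_le_integral (i2.const_mul _) (Filter.Eventually.of_forall fun x => by positivity)
      _ = _ := integral_const_mul _ _
  have b3 : ∫ x in {x : E | (n0:ℝ) - 1 ≤ rho x}, Real.exp (-(a * rho x)) *
          (‖fderiv ℝ f x‖ ^ 2 + f x ^ 2) ∂μ ≤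
      ∫ x, Real.exp (-(a * rho x)) * ‖fderiv ℝ f x‖ ^ 2 ∂μ + ∫ x, f x ^ 2 ∂μ := by
    refine (setIntegral_le_integral (exp_int (i1.add i2) ha.le)
      (Filter.Eventually.of_forall fun x => by
        show 0 ≤ Real.exp (-(a * rho x)) * (‖fderiv ℝ f x‖ ^ 2 + f x ^ 2)
        positivity)).trans ?_
    rw [← integral_add i3 i2]
    apply integral_mono (exp_int (i1.add i2) ha.le) (i3.add i2)
    intro x
    show Real.exp (-(a * rho x)) * (‖fderiv ℝ f x‖ ^ 2 + f x ^ 2) ≤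
      Real.exp (-(a * rho x)) * ‖fderiv ℝ f x‖ ^ 2 + f x ^ 2
    have : Real.exp (-(a * rho x)) ≤ 1 := by
      apply Real.exp_le_one_iff.2
      have := one_le_rho x
      have : 0 ≤ a * rho x := by positivity
      linarith
    nlinarith [sq_nonneg (f x)]
  rw [← integral_add_compl hm i5, b1]
  have g0 : 0 ≤ ∫ x, Real.exp (-(a * rho x)) * ‖fderiv ℝ f x‖ ^ 2 ∂μ :=
    integral_nonneg fun x => by positivity
  have := mul_le_mul_of_nonneg_left b3 K1p.le
  have := mul_nonneg (Real.exp_pos (a * n0)).le g0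
  linarith

lemma outer {μ : Measure E} [IsProbabilityMeasure μ] {a C : ℝ} (ha : 0 < a) (hC : 0 < C)
    {n0 : ℕ} (h : AnnIneq μ a C n0) : ∃ K > (0:ℝ), ∃ n1 : ℕ, ∀ f : E → ℝ, ContDiff ℝ (⊤ : ℕ∞) f →
      Integrable (fun x => f x ^ 2) μ → Integrable (fun x => ‖fderiv ℝ f x‖ ^ 2) μ →
      ∫ x, f x ^ 2 ∂μ ≤
        K * (∫ x, Real.exp (-(a * rho x)) * ‖fderiv ℝ f x‖ ^ 2 ∂μ + ∫ x in {x | rho x ≤ n1}, f x ^ 2 ∂μ) := by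
  set D := 4 * C * Real.exp (0 + 2 * (2 * a - 0)) with hD
  have Dp : 0 < D := by positivity
  obtain ⟨n2, hn2⟩ := exists_nat_ge (D / a)
  set n1 := max n0 n2 + 1 with hn1
  have hn1' : D / a ≤ n1 - 1 := by
    refine hn2.trans ?_
    rw [hn1]; push_cast
    have : (n2:ℝ) ≤ max (n0:ℝ) n2 := le_max_right _ _
    linarith
  have hsmall : D * Real.exp (-(2 * a * (n1 - 1))) ≤ 1 / 2 := by
    rw [Real.exp_neg, ← div_eq_mul_inv, div_le_iff₀ (Real.exp_pos _)]
    have := Real.add_one_le_exp (2 * a * (n1 - 1 : ℝ))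
    rw [div_le_iff₀ ha] at hn1'
    linarith
  refine ⟨2 * D + 2, by positivity, n1, fun f hf i2 i1 => ?_⟩
  have i3 := exp_int i1 ha.le
  set G := ∫ x, Real.exp (-(a * rho x)) * ‖fderiv ℝ f x‖ ^ 2 ∂μ with hG
  set Y := ∫ x in {x | rho x ≤ n1}, f x ^ 2 ∂μ with hY
  set X := ∫ x in {x | (n1:ℝ) ≤ rho x}, f x ^ 2 ∂μ with hX
  set Z := ∫ x, f x ^ 2 ∂μ with hZ
  have G0 : 0 ≤ G := integral_nonneg fun x => by positivity
  have Y0 : 0 ≤ Y := integral_nonneg fun x => by positivity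
  have hm : MeasurableSet {x : E | (n1:ℝ) ≤ rho x} := rho_ge_meas _
  have hZXY : Z ≤ X + Y := by
    rw [hZ, ← integral_add_compl hm i2]
    have : ∫ x in {x : E | (n1:ℝ) ≤ rho x}ᶜ, f x ^ 2 ∂μ ≤ Y := by
      apply setIntegral_mono_set i2.integrableOn (Filter.Eventually.of_forall fun x => sq_nonneg _)
      apply LE.le.eventuallyLE
      intro x hx
      by_contra hcon
      have hcon' : ¬ rho x ≤ n1 := hcon
      exact hx (show (n1:ℝ) ≤ rho x from (not_le.1 hcon').le)
    linarith
  have hN : ∀ N : ℕ, ∫ x in {x | (n1:ℝ) ≤ rho x ∧ rho x < N}, f x ^ 2 ∂μ ≤ D * G + 1 / 2 * Z := by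
    intro N
    have hw := weighted_sum hC h (t := 0) le_rfl (by linarith) (show n0 ≤ n1 by omega) N hf (i1.add i2)
    rw [← hD] at hw
    simp only [zero_mul, Real.exp_zero, one_mul, sub_zero] at hw
    refine hw.trans ?_
    have hm2 : MeasurableSet {x : E | (n1:ℝ) - 1 ≤ rho x} := rho_ge_meas _
    have : ∫ x in {x : E | (n1:ℝ) - 1 ≤ rho x}, Real.exp (-(2 * a * rho x)) *
          (‖fderiv ℝ f x‖ ^ 2 + f x ^ 2) ∂μ ≤ G + Real.exp (-(2 * a * (n1 - 1))) * Z := by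
      have i6 : Integrable (fun x => Real.exp (-(a * rho x)) * ‖fderiv ℝ f x‖ ^ 2 +
          Real.exp (-(2 * a * (n1 - 1))) * f x ^ 2) μ := i3.add (i2.const_mul _)
      calc _ ≤ ∫ x in {x : E | (n1:ℝ) - 1 ≤ rho x}, (Real.exp (-(a * rho x)) * ‖fderiv ℝ f x‖ ^ 2 +
          Real.exp (-(2 * a * (n1 - 1))) * f x ^ 2) ∂μ := by
            apply setIntegral_mono_on (exp_int (i1.add i2) (by positivity)).integrableOn i6.integrableOn hm2
            intro x hx
            have hx' : (n1:ℝ) - 1 ≤ rho x := hx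
            have e1 : Real.exp (-(2 * a * rho x)) ≤ Real.exp (-(a * rho x)) := by
              apply Real.exp_le_exp.2
              have := one_le_rho x
              have : 0 ≤ a * rho x := by positivity
              linarith
            have e2 : Real.exp (-(2 * a * rho x)) ≤ Real.exp (-(2 * a * (n1 - 1))) := by gcongr
            show Real.exp (-(2 * a * rho x)) * (‖fderiv ℝ f x‖ ^ 2 + f x ^ 2) ≤ _
            rw [mul_add]
            gcongr
        _ ≤ ∫ x, (Real.exp (-(a * rho x)) * ‖fderiv ℝ f x‖ ^ 2 +
          Real.exp (-(2 * a * (n1 - 1))) * f x ^ 2) ∂μ :=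
            setIntegral_le_integral i6 (Filter.Eventually.of_forall fun x => by positivity)
        _ = _ := by rw [integral_add i3 (i2.const_mul _), integral_const_mul]
    have Z0 : 0 ≤ Z := integral_nonneg fun x => by positivity
    calc _ ≤ D * (G + Real.exp (-(2 * a * (n1 - 1))) * Z) := by gcongr
      _ = D * G + (D * Real.exp (-(2 * a * (n1 - 1)))) * Z := by ring
      _ ≤ _ := by gcongr
  have hlim : X ≤ D * G + 1 / 2 * Z := by
    have hU : (⋃ N : ℕ, {x : E | (n1:ℝ) ≤ rho x ∧ rho x < N}) = {x : E | (n1:ℝ) ≤ rho x} := by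
      ext x
      simp only [mem_iUnion]
      constructor
      · rintro ⟨N, hN⟩; exact hN.1
      · intro hx
        obtain ⟨N, hN⟩ := exists_nat_gt (rho x)
        exact ⟨N, hx, hN⟩
    have ht := tendsto_setIntegral_of_monotone (μ := μ) (f := fun x => f x ^ 2)
      (s := fun N : ℕ => {x : E | (n1:ℝ) ≤ rho x ∧ rho x < N})
      (fun N => (measurableSet_le measurable_const rho_meas).inter (measurableSet_lt rho_meas measurable_const))
      (fun M N hMN x hx => ⟨hx.1, hx.2.trans_le (by exact_mod_cast hMN)⟩) i2.integrableOn
    rw [hU] at ht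
    exact le_of_tendsto' ht hN
  nlinarith

end

section
variable {d : ℕ}
local notation "E" => EuclideanSpace ℝ (Fin d)

lemma lint_scale {g : E → ENNReal} (hg : Measurable g) (z : E) {t : ℝ} (ht : 1 / 2 ≤ t) :
    ∫⁻ x, g (z + t • x) ≤ 2 ^ d * ∫⁻ x, g x := by
  have ht0 : 0 < t := by linarith
  have h1 : ∫⁻ x, g (z + t • x) = ∫⁻ y, g (z + y) ∂(Measure.map (fun x : E => t • x) volume) := by
    rw [lintegral_map]
    · exact hg.comp (measurable_const.add measurable_id)
    · exact measurable_const_smul t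
  rw [h1, Measure.map_addHaar_smul _ ht0.ne', lintegral_smul_measure, lintegral_add_left_eq_self]
  rw [smul_eq_mul]
  gcongr
  rw [finrank_euclideanSpace_fin, abs_of_pos (by positivity), ← inv_pow]
  have : t⁻¹ ^ d ≤ 2 ^ d := by
    gcongr
    rw [inv_le_comm₀ ht0 (by norm_num)]; linarith
  calc _ ≤ ENNReal.ofReal (2 ^ d) := ENNReal.ofReal_le_ofReal this
    _ = _ := by rw [ENNReal.ofReal_pow (by norm_num)]; simp

lemma cs_unit {h : ℝ → ℝ} (hh : Continuous h) :
    (∫ t in (0:ℝ)..1, h t) ^ 2 ≤ ∫ t in (0:ℝ)..1, h t ^ 2 := by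
  set m := ∫ t in (0:ℝ)..1, h t
  have h1 : 0 ≤ ∫ t in (0:ℝ)..1, (h t ^ 2 - 2 * m * h t + m ^ 2) := by
    apply intervalIntegral.integral_nonneg (by norm_num)
    intro t _
    nlinarith [sq_nonneg (h t - m)]
  have i1 : IntervalIntegrable (fun t => h t ^ 2) volume 0 1 := (hh.pow 2).intervalIntegrable _ _
  have i2 : IntervalIntegrable (fun t => 2 * m * h t) volume 0 1 :=
    (hh.const_mul (2 * m)).intervalIntegrable _ _
  rw [intervalIntegral.integral_add (i1.sub i2) (by simp), intervalIntegral.integral_sub i1 i2,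
    intervalIntegral.integral_const_mul] at h1
  simp at h1
  nlinarith

lemma seg_ineq {f : E → ℝ} (hf : ContDiff ℝ (⊤ : ℕ∞) f) (x y : E) :
    ENNReal.ofReal ((f x - f y) ^ 2) ≤ ENNReal.ofReal (‖x - y‖ ^ 2) *
      ∫⁻ t in Icc (0:ℝ) 1, ENNReal.ofReal (‖fderiv ℝ f (y + t • (x - y))‖ ^ 2) := by
  have hc : Continuous fun t : ℝ => ‖fderiv ℝ f (y + t • (x - y))‖ ^ 2 :=
    (cd_norm_cont hf).comp (by fun_prop)
  have hfc := hf.continuous_fderiv (by simp)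
  have hc2 : Continuous fun t : ℝ => fderiv ℝ f (y + t • (x - y)) (x - y) :=
    (hfc.comp (by fun_prop : Continuous fun t : ℝ => y + t • (x - y))).clm_apply continuous_const
  have h1 : ∫ t in (0:ℝ)..1, fderiv ℝ f (y + t • (x - y)) (x - y) = f x - f y := by
    have := intervalIntegral.integral_eq_sub_of_hasDerivAt (a := 0) (b := 1)
      (f := fun t : ℝ => f (y + t • (x - y))) (f' := fun t => fderiv ℝ f (y + t • (x - y)) (x - y))
      (fun t _ => ?_) (hc2.intervalIntegrable _ _)
    · simpa using this
    · have g1 : HasDerivAt (fun t : ℝ => y + t • (x - y)) (x - y) t := by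
        simpa using ((hasDerivAt_id t).smul_const (x - y)).const_add y
      exact ((hf.differentiable (by simp)) _).hasFDerivAt.comp_hasDerivAt t g1
  have h2 : (f x - f y) ^ 2 ≤ ‖x - y‖ ^ 2 * ∫ t in (0:ℝ)..1, ‖fderiv ℝ f (y + t • (x - y))‖ ^ 2 := by
    rw [← h1]
    refine (cs_unit hc2).trans ?_
    rw [← intervalIntegral.integral_const_mul]
    apply intervalIntegral.integral_mono_on (by norm_num) ((hc2.pow 2).intervalIntegrable _ _)
      ((hc.const_mul _).intervalIntegrable _ _)
    intro t _
    have ho := (fderiv ℝ f (y + t • (x - y))).le_opNorm (x - y)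
    have ho2 := pow_le_pow_left₀ (norm_nonneg _) ho 2
    rw [Real.norm_eq_abs, sq_abs, mul_pow, mul_comm] at ho2
    exact ho2
  rw [intervalIntegral.integral_of_le (by norm_num), ← integral_Icc_eq_integral_Ioc] at h2
  refine (ENNReal.ofReal_le_ofReal h2).trans ?_
  rw [ENNReal.ofReal_mul (by positivity), ofReal_integral_eq_lintegral_ofReal]
  · exact hc.continuousOn.integrableOn_compact isCompact_Icc
  · exact Filter.Eventually.of_forall fun t => sq_nonneg _

lemma local_leb {R : ℝ} (hR : 0 < R) {f : E → ℝ} (hf : ContDiff ℝ (⊤ : ℕ∞) f) :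
    ∃ m : ℝ, ∫⁻ x in Metric.closedBall (0:E) R, ENNReal.ofReal ((f x - m) ^ 2) ≤
      ENNReal.ofReal ((2 * R) ^ 2) * 2 ^ d *
        ∫⁻ x in Metric.closedBall (0:E) R, ENNReal.ofReal (‖fderiv ℝ f x‖ ^ 2) := by
  set B := Metric.closedBall (0:E) R with hB
  have hBm : MeasurableSet B := Metric.isClosed_closedBall.measurableSet
  have hBc : Convex ℝ B := convex_closedBall _ _
  have hB0 : (volume B) ≠ 0 := (Metric.measure_closedBall_pos volume _ hR).ne'
  have hBt : (volume B) ≠ ⊤ := measure_closedBall_lt_top.ne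
  set g : E → ENNReal := B.indicator fun x => ENNReal.ofReal (‖fderiv ℝ f x‖ ^ 2) with hg
  have hgm : Measurable g := (cd_norm_cont hf).measurable.ennreal_ofReal.indicator hBm
  have hgi : ∫⁻ x, g x = ∫⁻ x in B, ENNReal.ofReal (‖fderiv ℝ f x‖ ^ 2) := lintegral_indicator hBm _
  rw [← hgi]
  set G := ∫⁻ x, g x with hG
  have fc := hf.continuous
  -- pointwise
  have pt : ∀ y ∈ B, ∀ x ∈ B, ENNReal.ofReal ((f x - f y) ^ 2) ≤ ENNReal.ofReal ((2 * R) ^ 2) *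
      ∫⁻ t in Icc (0:ℝ) 1, g (y + t • (x - y)) := by
    intro y hy x hx
    refine (seg_ineq hf x y).trans ?_
    gcongr ENNReal.ofReal (?_ ^ 2) * ?_
    · rw [hB, Metric.mem_closedBall, dist_zero_right] at hx hy
      linarith [norm_sub_le x y]
    · apply setLIntegral_mono' measurableSet_Icc
      intro t ht
      rw [hg, indicator_of_mem]
      exact hBc.add_smul_sub_mem hy hx ht
  have tb : ∀ t ∈ Icc (0:ℝ) 1, ∫⁻ y in B, ∫⁻ x in B, g (y + t • (x - y)) ≤ 2 ^ d * G * volume B := by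
    intro t ht
    rcases le_total (1 / 2) t with h | h
    · have : ∀ y, ∫⁻ x in B, g (y + t • (x - y)) ≤ 2 ^ d * G := by
        intro y
        refine (setLIntegral_le_lintegral _ _).trans ?_
        have := lint_scale hgm (y - t • y) h
        refine le_trans (le_of_eq ?_) this
        congr 1; ext x; congr 1; rw [smul_sub]; abel
      calc _ ≤ ∫⁻ y in B, 2 ^ d * G := lintegral_mono fun y => this y
        _ = _ := setLIntegral_const _ _
    · rw [lintegral_lintegral_swap]
      · have : ∀ x, ∫⁻ y in B, g (y + t • (x - y)) ≤ 2 ^ d * G := by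
          intro x
          refine (setLIntegral_le_lintegral _ _).trans ?_
          have := lint_scale hgm (t • x) (t := 1 - t) (by linarith)
          refine le_trans (le_of_eq ?_) this
          congr 1; ext y; congr 1; rw [smul_sub, sub_smul, one_smul]; abel
        calc _ ≤ ∫⁻ y in B, 2 ^ d * G := lintegral_mono fun y => this y
          _ = _ := setLIntegral_const _ _
      · have : Measurable fun p : E × E => g (p.1 + t • (p.2 - p.1)) := hgm.comp (by fun_prop)
        exact this.aemeasurable
  have sw : ∫⁻ y in B, ∫⁻ x in B, ∫⁻ t in Icc (0:ℝ) 1, g (y + t • (x - y)) =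
      ∫⁻ t in Icc (0:ℝ) 1, ∫⁻ y in B, ∫⁻ x in B, g (y + t • (x - y)) := by
    have e1 : ∀ y, ∫⁻ x in B, ∫⁻ t in Icc (0:ℝ) 1, g (y + t • (x - y)) =
        ∫⁻ t in Icc (0:ℝ) 1, ∫⁻ x in B, g (y + t • (x - y)) := by
      intro y
      apply lintegral_lintegral_swap
      have : Measurable fun p : E × ℝ => g (y + p.2 • (p.1 - y)) := hgm.comp (by fun_prop)
      exact this.aemeasurable
    simp_rw [e1]
    apply lintegral_lintegral_swap
    have h1 : Measurable fun q : (E × ℝ) × E => g (q.1.1 + q.1.2 • (q.2 - q.1.1)) :=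
      hgm.comp (by fun_prop)
    have h2 : Measurable fun p : E × ℝ => ∫⁻ x in B, g (p.1 + p.2 • (x - p.1)) :=
      h1.lintegral_prod_right'
    exact h2.aemeasurable
  set F : E → ENNReal := fun y => ∫⁻ x in B, ENNReal.ofReal ((f x - f y) ^ 2) with hF
  have hFm : Measurable F := by
    have h1 : Measurable fun q : E × E => ENNReal.ofReal ((f q.2 - f q.1) ^ 2) := by
      apply Measurable.ennreal_ofReal
      apply Continuous.measurable
      fun_prop
    exact h1.lintegral_prod_right'
  obtain ⟨y, hy, hle⟩ := exists_le_setLAverage hB0 hBt hFm.aemeasurable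
  refine ⟨f y, hle.trans ?_⟩
  rw [setLAverage_eq]
  apply ENNReal.div_le_of_le_mul
  calc ∫⁻ y in B, F y ≤ ∫⁻ y in B, ∫⁻ x in B, ENNReal.ofReal ((2 * R) ^ 2) *
        ∫⁻ t in Icc (0:ℝ) 1, g (y + t • (x - y)) := by
          apply setLIntegral_mono' hBm
          intro y hy
          apply setLIntegral_mono' hBm
          intro x hx
          exact pt y hy x hx
    _ = ENNReal.ofReal ((2 * R) ^ 2) * ∫⁻ y in B, ∫⁻ x in B, ∫⁻ t in Icc (0:ℝ) 1, g (y + t • (x - y)) := by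
          have : ∀ y, ∫⁻ x in B, ENNReal.ofReal ((2 * R) ^ 2) * ∫⁻ t in Icc (0:ℝ) 1, g (y + t • (x - y))
            = ENNReal.ofReal ((2 * R) ^ 2) * ∫⁻ x in B, ∫⁻ t in Icc (0:ℝ) 1, g (y + t • (x - y)) :=
            fun y => lintegral_const_mul' _ _ ENNReal.ofReal_ne_top
          simp_rw [this]
          exact lintegral_const_mul' _ _ ENNReal.ofReal_ne_top
    _ ≤ ENNReal.ofReal ((2 * R) ^ 2) * (2 ^ d * G * volume B) := by
          gcongr
          rw [sw]
          calc _ ≤ ∫⁻ t in Icc (0:ℝ) 1, 2 ^ d * G * volume B := setLIntegral_mono' measurableSet_Icc tb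
            _ = _ := by rw [setLIntegral_const]; simp
    _ = _ := by ring

lemma local_poinc {V : E → ℝ} (hV : Continuous V) {μ : Measure E} [IsProbabilityMeasure μ]
    (hμ : μ = volume.withDensity (fun x => ENNReal.ofReal (Real.exp (V x)))) (a : ℝ) {R : ℝ} (hR : 0 < R) :
    ∃ K > (0:ℝ), ∀ f : E → ℝ, ContDiff ℝ (⊤ : ℕ∞) f →
      ∃ m : ℝ, ∫ x in Metric.closedBall (0:E) R, (f x - m) ^ 2 ∂μ ≤
        K * ∫ x in Metric.closedBall (0:E) R, Real.exp (-(a * rho x)) * ‖fderiv ℝ f x‖ ^ 2 ∂μ := by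
  set B := Metric.closedBall (0:E) R with hB
  have hBk : IsCompact B := isCompact_closedBall _ _
  have hBm : MeasurableSet B := Metric.isClosed_closedBall.measurableSet
  have rc := (rho_cd (d := d)).continuous
  obtain ⟨M, hM⟩ := hBk.exists_bound_of_continuousOn hV.continuousOn
  obtain ⟨M2, hM2⟩ := hBk.exists_bound_of_continuousOn (f := fun x => V x - a * rho x)
    (by fun_prop : Continuous fun x => V x - a * rho x).continuousOn
  refine ⟨Real.exp M * ((2 * R) ^ 2 * 2 ^ d * Real.exp M2), by positivity, fun f hf => ?_⟩
  obtain ⟨m, hm⟩ := local_leb hR hf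
  refine ⟨m, ?_⟩
  have fc := hf.continuous
  have gc := cd_norm_cont hf
  have wd : ∀ h : E → ℝ, Continuous h → ∫⁻ x in B, ENNReal.ofReal (h x) ∂μ =
      ∫⁻ x in B, ENNReal.ofReal (Real.exp (V x)) * ENNReal.ofReal (h x) := by
    intro h hh
    rw [hμ]
    exact setLIntegral_withDensity_eq_setLIntegral_mul _ (by fun_prop) (by fun_prop) hBm
  have i1 : IntegrableOn (fun x => (f x - m) ^ 2) B μ :=
    (by fun_prop : Continuous fun x => (f x - m) ^ 2).continuousOn.integrableOn_compact hBk
  have c2 : Continuous fun x => Real.exp (-(a * rho x)) * ‖fderiv ℝ f x‖ ^ 2 := by fun_prop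
  have i2 : IntegrableOn (fun x => Real.exp (-(a * rho x)) * ‖fderiv ℝ f x‖ ^ 2) B μ :=
    c2.continuousOn.integrableOn_compact hBk
  have r0 : 0 ≤ ∫ x in B, Real.exp (-(a * rho x)) * ‖fderiv ℝ f x‖ ^ 2 ∂μ :=
    integral_nonneg fun x => by positivity
  rw [← ENNReal.ofReal_le_ofReal_iff (by positivity), ENNReal.ofReal_mul (by positivity),
    ofReal_integral_eq_lintegral_ofReal i1 (Filter.Eventually.of_forall fun x => sq_nonneg _),
    ofReal_integral_eq_lintegral_ofReal i2 (Filter.Eventually.of_forall fun x => by positivity),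
    wd _ (by fun_prop), wd _ c2]
  have s1 : ∫⁻ x in B, ENNReal.ofReal (Real.exp (V x)) * ENNReal.ofReal ((f x - m) ^ 2) ≤
      ENNReal.ofReal (Real.exp M) * ∫⁻ x in B, ENNReal.ofReal ((f x - m) ^ 2) := by
    rw [← lintegral_const_mul' _ _ ENNReal.ofReal_ne_top]
    apply setLIntegral_mono' hBm
    intro x hx
    gcongr
    exact (le_abs_self _).trans (hM x hx)
  have s2 : ∫⁻ x in B, ENNReal.ofReal (‖fderiv ℝ f x‖ ^ 2) ≤ ENNReal.ofReal (Real.exp M2) *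
      ∫⁻ x in B, ENNReal.ofReal (Real.exp (V x)) *
        ENNReal.ofReal (Real.exp (-(a * rho x)) * ‖fderiv ℝ f x‖ ^ 2) := by
    rw [← lintegral_const_mul' _ _ ENNReal.ofReal_ne_top]
    apply setLIntegral_mono' hBm
    intro x hx
    rw [← ENNReal.ofReal_mul (by positivity), ← ENNReal.ofReal_mul (by positivity)]
    apply ENNReal.ofReal_le_ofReal
    rw [← mul_assoc, ← mul_assoc, ← Real.exp_add, ← Real.exp_add]
    apply le_mul_of_one_le_left (sq_nonneg _)
    apply Real.one_le_exp
    have := hM2 x hx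
    rw [Real.norm_eq_abs] at this
    linarith [neg_abs_le (V x - a * rho x)]
  refine s1.trans ?_
  rw [ENNReal.ofReal_mul (by positivity), mul_assoc]
  gcongr
  refine hm.trans ?_
  rw [ENNReal.ofReal_mul (by positivity), mul_assoc, ENNReal.ofReal_mul (by positivity), mul_assoc, mul_assoc]
  gcongr
  rw [ENNReal.ofReal_pow (by norm_num)]; simp

end

section
variable {d : ℕ}
local notation "E" => EuclideanSpace ℝ (Fin d)

/-- one-dimensional level cutoff -/
noncomputable def lev (t : ℝ) : ℝ := T (t ^ 2 - 1)

lemma lev_cd : ContDiff ℝ (⊤ : ℕ∞) lev := T_cd.comp ((contDiff_id.pow 2).sub contDiff_const)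

lemma lev_deriv (t : ℝ) : deriv lev t = deriv T (t ^ 2 - 1) * (2 * t) := by
  have h1 : HasDerivAt (fun t : ℝ => t ^ 2 - 1) (2 * t) t := by
    simpa using (hasDerivAt_pow 2 t).sub_const 1
  have h2 : HasDerivAt T (deriv T (t ^ 2 - 1)) (t ^ 2 - 1) :=
    ((T_cd.differentiable (by simp)) _).hasDerivAt
  exact (h2.comp t h1).deriv

lemma lev_deriv_zero {t : ℝ} (h : |t| ≤ 1 ∨ 2 ≤ |t|) : deriv lev t = 0 := by
  rw [lev_deriv, T_deriv_zero, zero_mul]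
  rw [← sq_abs]
  have := abs_nonneg t
  rcases h with h | h
  · left; nlinarith
  · right; nlinarith

lemma lev_deriv_le {L : ℝ} (hL : ∀ t, |deriv T t| ≤ L) (hL1 : 1 ≤ L) (t : ℝ) : |deriv lev t| ≤ 4 * L := by
  by_cases h : 2 ≤ |t|
  · rw [lev_deriv_zero (Or.inr h)]; simp; linarith
  · rw [lev_deriv, abs_mul, abs_mul]
    have := hL (t ^ 2 - 1)
    have h0 := abs_nonneg (deriv T (t ^ 2 - 1))
    have h2 := abs_nonneg t
    simp only [Nat.abs_ofNat]
    push Not at h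
    nlinarith

lemma lev_nonneg (t : ℝ) : 0 ≤ lev t := Real.smoothTransition.nonneg _
lemma lev_le_one (t : ℝ) : lev t ≤ 1 := Real.smoothTransition.le_one _
lemma lev_zero {t : ℝ} (h : |t| ≤ 1) : lev t = 0 :=
  Real.smoothTransition.zero_of_nonpos (by rw [← sq_abs]; nlinarith [abs_nonneg t])
lemma lev_one {t : ℝ} (h : 2 ≤ |t|) : lev t = 1 :=
  Real.smoothTransition.one_of_one_le (by rw [← sq_abs]; nlinarith [abs_nonneg t])

/-- smooth truncation removing small values -/
noncomputable def big (t : ℝ) : ℝ := t * lev (t / 2)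

lemma big_cd : ContDiff ℝ (⊤ : ℕ∞) big :=
  contDiff_id.mul (lev_cd.comp (contDiff_id.div_const 2))

lemma big_deriv_le {L : ℝ} (hL : ∀ t, |deriv T t| ≤ L) (hL1 : 1 ≤ L) (t : ℝ) : |deriv big t| ≤ 9 * L := by
  have h1 : HasDerivAt (fun t : ℝ => t / 2) (1 / 2) t := (hasDerivAt_id t).div_const 2
  have h2 : HasDerivAt lev (deriv lev (t / 2)) (t / 2) :=
    ((lev_cd.differentiable (by simp)) _).hasDerivAt
  have h3 := (hasDerivAt_id t).mul (h2.comp t h1)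
  have h4 : deriv big t = 1 * lev (t / 2) + t * (deriv lev (t / 2) * (1 / 2)) := h3.deriv
  rw [h4]
  have e0 := lev_nonneg (t / 2)
  have e1 := lev_le_one (t / 2)
  have e2 : |t * (deriv lev (t / 2) * (1 / 2))| ≤ 8 * L := by
    by_cases h : 2 ≤ |t / 2|
    · rw [lev_deriv_zero (Or.inr h)]; simp; linarith
    · have : t * (deriv lev (t / 2) * (1 / 2)) = (t / 2) * deriv lev (t / 2) := by ring
      rw [this, abs_mul]
      push Not at h
      have := lev_deriv_le hL hL1 (t / 2)
      nlinarith [abs_nonneg (t / 2), abs_nonneg (deriv lev (t / 2))]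
  rw [one_mul]
  refine (abs_add_le _ _).trans ?_
  rw [abs_of_nonneg e0]
  linarith

lemma big_zero {t : ℝ} (h : |t| ≤ 2) : big t = 0 := by
  rw [big, lev_zero, mul_zero]
  rw [abs_div]; simp only [Nat.abs_ofNat]; linarith

lemma big_eq {t : ℝ} (h : 4 ≤ |t|) : big t = t := by
  rw [big, lev_one, mul_one]
  rw [abs_div]; simp only [Nat.abs_ofNat]; linarith

lemma big_sq_le (t : ℝ) : big t ^ 2 ≤ t ^ 2 := by
  rw [big, mul_pow, mul_comm]
  exact sq_mul_le (lev_nonneg _) (lev_le_one _) (sq_nonneg _) le_rfl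

/-- pointwise entropy bound -/
lemma ent_pt {t M : ℝ} (hM : 1 ≤ M) (h : |t| ≤ M) :
    t ^ 2 * Real.log (t ^ 2) ≤ t ^ 2 - 1 + (2 * M + 1) * (|t| - 1) ^ 2 := by
  rw [← sq_abs t]
  set s := |t| with hs
  have s0 : 0 ≤ s := abs_nonneg t
  rcases s0.eq_or_lt with h0 | h0
  · rw [← h0]; norm_num; linarith
  · have hl : Real.log (s ^ 2) ≤ 2 * (s - 1) := by
      rw [Real.log_pow]
      have := Real.log_le_sub_one_of_pos h0
      push_cast; linarith
    have h1 : s ^ 2 * Real.log (s ^ 2) ≤ s ^ 2 * (2 * (s - 1)) := by gcongr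
    nlinarith [mul_nonneg (sub_nonneg.2 h) (sq_nonneg (s - 1))]

lemma sum_lev1 (t : ℝ) (k0 : ℕ) (hk0 : 1 ≤ k0) (K : ℕ) (ht : 0 ≤ t) :
    ∑ k ∈ Finset.Ico k0 K, (if (2:ℝ) ^ k ≤ t then (4:ℝ) ^ k else 0) ≤
      2 * (if 2 ≤ t then t ^ 2 else 0) := by
  have gen : ∀ K : ℕ, ∑ k ∈ Finset.Ico k0 K, (4:ℝ) ^ k ≤ 4 ^ K / 2 := by
    intro K
    induction K with
    | zero => simp
    | succ K ih =>
      by_cases h : k0 ≤ K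
      · rw [Finset.sum_Ico_succ_top h, pow_succ]
        have : (0:ℝ) < 4 ^ K := by positivity
        linarith
      · rw [Finset.Ico_eq_empty (by omega)]; simp; positivity
  induction K with
  | zero => simp; split_ifs <;> positivity
  | succ K ih =>
    by_cases h : k0 ≤ K
    · by_cases h2 : (2:ℝ) ^ K ≤ t
      · have h3 : (2:ℝ) ≤ t := by
          refine le_trans ?_ h2
          calc (2:ℝ) = 2 ^ 1 := by norm_num
            _ ≤ _ := pow_le_pow_right₀ (by norm_num) (by omega)
        rw [if_pos h3]
        have h4 : ∑ k ∈ Finset.Ico k0 (K + 1), (if (2:ℝ) ^ k ≤ t then (4:ℝ) ^ k else 0) ≤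
            ∑ k ∈ Finset.Ico k0 (K + 1), (4:ℝ) ^ k := by
          apply Finset.sum_le_sum
          intro k _
          split_ifs
          · exact le_rfl
          · positivity
        have h5 := gen (K + 1)
        have h6 : (4:ℝ) ^ K ≤ t ^ 2 := by
          calc (4:ℝ) ^ K = (2 ^ K) ^ 2 := by rw [← pow_mul, mul_comm, pow_mul]; norm_num
            _ ≤ _ := by gcongr
        rw [pow_succ] at h5
        linarith
      · rw [Finset.sum_Ico_succ_top h, if_neg h2, add_zero]; exact ih
    · rw [Finset.Ico_eq_empty (by omega)]; simp; split_ifs <;> positivity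

lemma sum_lev2 (t : ℝ) (k0 K : ℕ) :
    ∑ k ∈ Finset.Ico k0 K, (if (2:ℝ) ^ k ≤ t ∧ t < 2 ^ (k + 1) then (1:ℝ) else 0) ≤ 1 := by
  induction K with
  | zero => simp
  | succ K ih =>
    by_cases h : k0 ≤ K
    · rw [Finset.sum_Ico_succ_top h]
      by_cases h2 : (2:ℝ) ^ K ≤ t ∧ t < 2 ^ (K + 1)
      · rw [if_pos h2]
        have : ∑ k ∈ Finset.Ico k0 K, (if (2:ℝ) ^ k ≤ t ∧ t < 2 ^ (k + 1) then (1:ℝ) else 0) = 0 := by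
          apply Finset.sum_eq_zero
          intro k hk
          rw [if_neg]
          rintro ⟨_, h3⟩
          have : (2:ℝ) ^ (k + 1) ≤ 2 ^ K :=
            pow_le_pow_right₀ (by norm_num) (by have := (Finset.mem_Ico.1 hk).2; omega)
          linarith [h2.1]
        rw [this]; simp
      · rw [if_neg h2, add_zero]; exact ih
    · rw [Finset.Ico_eq_empty (by omega)]; simp

lemma wpoinc {V : E → ℝ} (hV : Continuous V) {μ : Measure E} [IsProbabilityMeasure μ]
    (hμ : μ = volume.withDensity (fun x => ENNReal.ofReal (Real.exp (V x))))
    {a C : ℝ} (ha : 0 < a) (hC : 0 < C) {n0 : ℕ} (h : AnnIneq μ a C n0) :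
    ∃ K > (0:ℝ), ∀ f : E → ℝ, ContDiff ℝ (⊤ : ℕ∞) f → HasCompactSupport f → ∫ x, f x ^ 2 ∂μ = 1 →
      ∫ x, (|f x| - 1) ^ 2 ∂μ ≤ K * ∫ x, Real.exp (-(a * rho x)) * ‖fderiv ℝ f x‖ ^ 2 ∂μ := by
  obtain ⟨K1, hK1, n1, h1⟩ := outer ha hC h
  obtain ⟨K2, hK2, h2⟩ := local_poinc hV hμ a (show (0:ℝ) < n1 + 1 by positivity)
  refine ⟨2 * (K1 * (1 + K2)), by positivity, fun f hf hs hn => ?_⟩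
  obtain ⟨m, hm⟩ := h2 f hf
  have i0 : Integrable f μ := int_cs hf.continuous hs
  have i1 : Integrable (fun x => |f x|) μ := i0.abs
  have i2 := cs_sq_int (μ := μ) hf.continuous hs
  have ig := cs_grad_int (μ := μ) hf hs
  have ieg := exp_int ig ha.le
  set G := ∫ x, Real.exp (-(a * rho x)) * ‖fderiv ℝ f x‖ ^ 2 ∂μ with hG
  have e1 : (fun x => (f x - m) ^ 2) = fun x => f x ^ 2 - 2 * m * f x + m ^ 2 := by ext x; ring
  have i3a : Integrable (fun x => f x ^ 2 - 2 * m * f x) μ := i2.sub (i0.const_mul _)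
  have i3 : Integrable (fun x => (f x - m) ^ 2) μ := by
    rw [e1]; exact i3a.add (integrable_const _)
  have e2 : (fun x => fderiv ℝ (fun x => f x - m) x) = fderiv ℝ f := by
    ext1 x; exact fderiv_sub_const m
  have e2' : ∀ x, fderiv ℝ (fun x => f x - m) x = fderiv ℝ f x := fun x => congrFun e2 x
  have ho := h1 (fun x => f x - m) (hf.sub contDiff_const) i3 (by simp_rw [e2']; exact ig)
  simp_rw [e2'] at ho
  rw [← hG] at ho
  have l1 : ∫ x in {x : E | rho x ≤ n1}, (f x - m) ^ 2 ∂μ ≤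
      ∫ x in Metric.closedBall (0:E) (n1 + 1), (f x - m) ^ 2 ∂μ := by
    apply setIntegral_mono_set i3.integrableOn (Filter.Eventually.of_forall fun x => sq_nonneg _)
    apply LE.le.eventuallyLE
    intro x hx
    have hx' : rho x ≤ n1 := hx
    show x ∈ Metric.closedBall (0:E) (n1 + 1)
    rw [Metric.mem_closedBall, dist_zero_right]
    linarith [norm_le_rho x]
  have l2 : ∫ x in Metric.closedBall (0:E) (n1 + 1), Real.exp (-(a * rho x)) * ‖fderiv ℝ f x‖ ^ 2 ∂μ ≤ G :=
    setIntegral_le_integral ieg (Filter.Eventually.of_forall fun x => by positivity)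
  have l3 : ∫ x, (f x - m) ^ 2 ∂μ ≤ K1 * (1 + K2) * G := by
    refine ho.trans ?_
    rw [mul_assoc]
    gcongr
    have := mul_le_mul_of_nonneg_left l2 hK2.le
    linarith
  -- variance
  have v1 : ∫ x, (f x - m) ^ 2 ∂μ = 1 - 2 * m * ∫ x, f x ∂μ + m ^ 2 := by
    rw [e1, integral_add i3a (integrable_const _), integral_sub i2 (i0.const_mul _),
      integral_const_mul, hn]; simp
  have e3 : (fun x => (|f x| - 1) ^ 2) = fun x => f x ^ 2 - 2 * |f x| + 1 := by
    ext x; rw [← sq_abs (f x)]; ring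
  have i4 : Integrable (fun x => f x ^ 2 - 2 * |f x|) μ := i2.sub (i1.const_mul _)
  have v2 : ∫ x, (|f x| - 1) ^ 2 ∂μ = 2 - 2 * ∫ x, |f x| ∂μ := by
    rw [e3, integral_add i4 (integrable_const _), integral_sub i2 (i1.const_mul _),
      integral_const_mul, hn]; simp; ring
  have v3 : |∫ x, f x ∂μ| ≤ ∫ x, |f x| ∂μ := abs_integral_le_integral_abs
  have v4 : 0 ≤ ∫ x, (|f x| - 1) ^ 2 ∂μ := integral_nonneg fun x => sq_nonneg _
  rw [v2] at v4 ⊢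
  have v5 : (∫ x, f x ∂μ) ^ 2 ≤ (∫ x, |f x| ∂μ) ^ 2 := by
    rw [← sq_abs (∫ x, f x ∂μ)]; gcongr
  have v6 : 0 ≤ ∫ x, |f x| ∂μ := integral_nonneg fun x => abs_nonneg _
  nlinarith [sq_nonneg (m - ∫ x, f x ∂μ)]

end

section
variable {d : ℕ}
local notation "E" => EuclideanSpace ℝ (Fin d)

lemma ite_int {μ : Measure E} {g : E → ℝ} (hg : Integrable g μ) {p : E → Prop} [DecidablePred p]
    (hp : MeasurableSet {x | p x}) : Integrable (fun x => if p x then g x else 0) μ := by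
  have e : (fun x => if p x then g x else 0) = {x | p x}.indicator g := by
    funext x
    by_cases h : p x
    · rw [if_pos h, indicator_of_mem (show x ∈ {x | p x} from h)]
    · rw [if_neg h, indicator_of_notMem (show x ∉ {x | p x} from h)]
  rw [e]
  exact hg.indicator hp

/-- level set test function, cut off in space -/
noncomputable def gk (a : ℝ) (f : EuclideanSpace ℝ (Fin d) → ℝ) (k : ℕ)
    (x : EuclideanSpace ℝ (Fin d)) : ℝ :=
  lev (f x / 2 ^ k) * cut (-1) (Real.log k / a + 1) x

lemma levk_cd {f : E → ℝ} (hf : ContDiff ℝ (⊤ : ℕ∞) f) (k : ℕ) :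
    ContDiff ℝ (⊤ : ℕ∞) (fun x => lev (f x / 2 ^ k)) :=
  lev_cd.comp (hf.div_const _)

lemma gk_cd (a : ℝ) {f : E → ℝ} (hf : ContDiff ℝ (⊤ : ℕ∞) f) (k : ℕ) :
    ContDiff ℝ (⊤ : ℕ∞) (gk a f k) :=
  (levk_cd hf k).mul (cut_cd _ _)

lemma gk_zero (a : ℝ) {f : E → ℝ} {k : ℕ} {x : E} (h : |f x| ≤ 2 ^ k) : gk a f k x = 0 := by
  rw [gk, lev_zero, zero_mul]
  rw [abs_div, abs_of_pos (by positivity : (0:ℝ) < 2 ^ k), div_le_one (by positivity)]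
  exact h

lemma gk_cs (a : ℝ) {f : E → ℝ} (hs : HasCompactSupport f) (k : ℕ) :
    HasCompactSupport (gk a f k) := by
  obtain ⟨N, hN⟩ := cs_bdd hs
  apply hcs_of_rho (R := N)
  intro x hx
  apply gk_zero
  rw [hN x hx]; simp

lemma levk_grad {L : ℝ} (hL : ∀ t, |deriv T t| ≤ L) (hL1 : 1 ≤ L) {f : E → ℝ}
    (hf : ContDiff ℝ (⊤ : ℕ∞) f) (k : ℕ) (x : E) :
    (4:ℝ) ^ k * ‖fderiv ℝ (fun x => lev (f x / 2 ^ k)) x‖ ^ 2 ≤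
      16 * L ^ 2 * ((if (2:ℝ) ^ k ≤ |f x| ∧ |f x| < 2 ^ (k + 1) then 1 else 0) *
        ‖fderiv ℝ f x‖ ^ 2) := by
  have p2 : (0:ℝ) < 2 ^ k := by positivity
  have e : ‖fderiv ℝ (fun x => lev (f x / 2 ^ k)) x‖ =
      |deriv lev (f x / 2 ^ k)| * (‖fderiv ℝ f x‖ / 2 ^ k) := by
    rw [fderiv_comp_scalar lev_cd (hf.div_const _) x]
    congr 1
    have : fderiv ℝ (fun x => f x / 2 ^ k) x = ((2:ℝ) ^ k)⁻¹ • fderiv ℝ f x := by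
      have h0 : (fun x => f x / 2 ^ k) = fun x => ((2:ℝ) ^ k)⁻¹ • f x := by
        funext y; simp [div_eq_inv_mul]
      rw [h0]
      exact fderiv_const_smul ((hf.differentiable (by simp)) x) (((2:ℝ) ^ k)⁻¹)
    rw [this, norm_smul, Real.norm_eq_abs, abs_of_pos (by positivity), div_eq_inv_mul]
  rw [e]
  have h4 : (4:ℝ) ^ k = (2 ^ k) ^ 2 := by rw [← pow_mul, mul_comm, pow_mul]; norm_num
  have e2 : (4:ℝ) ^ k * (|deriv lev (f x / 2 ^ k)| * (‖fderiv ℝ f x‖ / 2 ^ k)) ^ 2 =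
      |deriv lev (f x / 2 ^ k)| ^ 2 * ‖fderiv ℝ f x‖ ^ 2 := by
    rw [h4]; field_simp
  rw [e2]
  split_ifs with h
  · have h5 := lev_deriv_le hL hL1 (f x / 2 ^ k)
    have h6 : |deriv lev (f x / 2 ^ k)| ^ 2 ≤ (4 * L) ^ 2 := by gcongr
    have := mul_le_mul_of_nonneg_right h6 (sq_nonneg ‖fderiv ℝ f x‖)
    nlinarith
  · rw [lev_deriv_zero]
    · simp
    · rw [abs_div, abs_of_pos p2, div_le_one p2, le_div_iff₀ p2]
      by_contra hh
      push Not at hh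
      apply h
      refine ⟨hh.1.le, ?_⟩
      rw [pow_succ]; linarith [hh.2]

lemma gk_grad {L : ℝ} (hL : ∀ t, |deriv T t| ≤ L) (hL1 : 1 ≤ L) {a : ℝ} (ha : 0 < a) {f : E → ℝ}
    (hf : ContDiff ℝ (⊤ : ℕ∞) f) {k : ℕ} (hk : 1 ≤ k) (x : E) :
    (4:ℝ) ^ k / k * ‖fderiv ℝ (gk a f k) x‖ ^ 2 ≤
      32 * L ^ 2 * Real.exp a * ((if (2:ℝ) ^ k ≤ |f x| then 4 ^ k else 0) +
        (if (2:ℝ) ^ k ≤ |f x| ∧ |f x| < 2 ^ (k + 1) then 1 else 0) *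
          (Real.exp (-(a * rho x)) * ‖fderiv ℝ f x‖ ^ 2)) := by
  have k1 : (1:ℝ) ≤ k := by exact_mod_cast hk
  have k0 : (0:ℝ) < k := by linarith
  set R := Real.log k / a with hR
  have h1 := fderiv_mul_sq (levk_cd hf k) (cut_cd (d := d) (-1) (R + 1)) x
  have h1' : ‖fderiv ℝ (gk a f k) x‖ ^ 2 ≤ _ := h1
  have h2 := levk_grad hL hL1 hf k x
  have ea : 1 ≤ Real.exp a := Real.one_le_exp ha.le
  set I1 : ℝ := (if (2:ℝ) ^ k ≤ |f x| then 4 ^ k else 0) with hI1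
  set I2 : ℝ := (if (2:ℝ) ^ k ≤ |f x| ∧ |f x| < 2 ^ (k + 1) then 1 else 0) with hI2
  set G := ‖fderiv ℝ f x‖ ^ 2
  set G1 := ‖fderiv ℝ (fun x => lev (f x / 2 ^ k)) x‖ ^ 2
  set G2 := ‖fderiv ℝ (cut (d := d) (-1) (R + 1)) x‖ ^ 2
  set u := lev (f x / 2 ^ k)
  set v := cut (-1) (R + 1) x
  have G0 : 0 ≤ G := by positivity
  have I10 : 0 ≤ I1 := by rw [hI1]; split_ifs <;> positivity
  have I20 : 0 ≤ I2 := by rw [hI2]; split_ifs <;> positivity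
  have hG2 : G2 ≤ L ^ 2 := by
    have := cut_fderiv_le (d := d) hL (-1) (R + 1) x
    simp only [abs_neg, abs_one, mul_one] at this
    exact pow_le_pow_left₀ (norm_nonneg _) this 2
  have A1 : (4:ℝ) ^ k / k * (u ^ 2 * G2) ≤ L ^ 2 * I1 := by
    by_cases hh : (2:ℝ) ^ k ≤ |f x|
    · rw [hI1, if_pos hh]
      have u1 : u ^ 2 * G2 ≤ L ^ 2 := sq_mul_le (lev_nonneg _) (lev_le_one _) (by positivity) hG2
      have : (4:ℝ) ^ k / k ≤ 4 ^ k := div_le_self (by positivity) k1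
      calc _ ≤ (4:ℝ) ^ k * L ^ 2 := by gcongr
        _ = _ := mul_comm _ _
    · have : u = 0 := by
        apply lev_zero
        rw [abs_div, abs_of_pos (by positivity : (0:ℝ) < 2 ^ k), div_le_one (by positivity)]
        push Not at hh; exact hh.le
      rw [this]; simp; positivity
  have A2 : (4:ℝ) ^ k / k * (v ^ 2 * G1) ≤ 16 * L ^ 2 * Real.exp a *
      (I2 * (Real.exp (-(a * rho x)) * G)) := by
    by_cases hh : -1 * rho x + (R + 1) ≤ 0
    · have : v = 0 := cut_zero hh
      rw [this]; simp; positivity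
    · push Not at hh
      have hr : rho x ≤ R + 1 := by linarith
      have v1 : v ^ 2 * G1 ≤ G1 :=
        sq_mul_le (cut_nonneg _ _ _) (cut_le_one _ _ _) (by positivity) le_rfl
      have hk' : 1 / (k:ℝ) ≤ Real.exp a * Real.exp (-(a * rho x)) := by
        have : 1 / (k:ℝ) = Real.exp (-Real.log k) := by
          rw [Real.exp_neg, Real.exp_log k0, one_div]
        rw [this, ← Real.exp_add]
        apply Real.exp_le_exp.2
        have : a * R = Real.log k := by rw [hR]; field_simp
        nlinarith
      calc (4:ℝ) ^ k / k * (v ^ 2 * G1) ≤ (4:ℝ) ^ k / k * G1 := by gcongr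
        _ = 1 / (k:ℝ) * (4 ^ k * G1) := by ring
        _ ≤ (Real.exp a * Real.exp (-(a * rho x))) * (16 * L ^ 2 * (I2 * G)) := by gcongr
        _ = _ := by ring
  calc (4:ℝ) ^ k / k * ‖fderiv ℝ (gk a f k) x‖ ^ 2 ≤
      (4:ℝ) ^ k / k * (2 * (u ^ 2 * G2 + v ^ 2 * G1)) := by gcongr
    _ = 2 * ((4:ℝ) ^ k / k * (u ^ 2 * G2)) + 2 * ((4:ℝ) ^ k / k * (v ^ 2 * G1)) := by ring
    _ ≤ 2 * (L ^ 2 * I1) + 2 * (16 * L ^ 2 * Real.exp a * (I2 * (Real.exp (-(a * rho x)) * G))) := by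
        gcongr
    _ ≤ _ := by
        have : L ^ 2 * I1 ≤ 16 * (L ^ 2 * I1 * Real.exp a) := by
          have h0 : 0 ≤ L ^ 2 * I1 := by positivity
          nlinarith
        nlinarith

lemma markov_lev {μ : Measure E} [IsProbabilityMeasure μ] {f : E → ℝ}
    (hf : Continuous f) (hs : HasCompactSupport f) (h1 : ∫ x, f x ^ 2 ∂μ = 1) (k : ℕ) :
    (4:ℝ) ^ k * μ.real {x | (2:ℝ) ^ k ≤ |f x|} ≤ 1 := by
  have := mul_meas_ge_le_integral_of_nonneg (μ := μ) (f := fun x => f x ^ 2)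
    (Filter.Eventually.of_forall fun x => sq_nonneg _) (cs_sq_int hf hs) ((4:ℝ) ^ k)
  rw [h1] at this
  convert this using 4
  ext x
  have h4 : (4:ℝ) ^ k = (2 ^ k) ^ 2 := by rw [← pow_mul, mul_comm, pow_mul]; norm_num
  show (2:ℝ) ^ k ≤ |f x| ↔ (4:ℝ) ^ k ≤ f x ^ 2
  rw [h4, ← sq_abs (f x), pow_le_pow_iff_left₀ (by positivity) (abs_nonneg _) (by norm_num)]

lemma gk_int {μ : Measure E} [IsProbabilityMeasure μ] {c : ℝ} (hc : 0 < c) (hSP : SPI μ c)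
    {L : ℝ} (hL : ∀ t, |deriv T t| ≤ L) (hL1 : 1 ≤ L) {a : ℝ} (ha : 0 < a) {f : E → ℝ}
    (hf : ContDiff ℝ (⊤ : ℕ∞) f) (hs : HasCompactSupport f) (h1 : ∫ x, f x ^ 2 ∂μ = 1)
    {k : ℕ} (hk : 1 ≤ k) (hkc : 2 * c + 2 ≤ k) :
    k * 4 ^ k * ∫ x, gk a f k x ^ 2 ∂μ ≤ 256 * c ^ 2 * L ^ 2 * Real.exp a *
      ∫ x, ((if (2:ℝ) ^ k ≤ |f x| then 4 ^ k else 0) +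
        (if (2:ℝ) ^ k ≤ |f x| ∧ |f x| < 2 ^ (k + 1) then 1 else 0) *
          (Real.exp (-(a * rho x)) * ‖fderiv ℝ f x‖ ^ 2)) ∂μ := by
  have k0 : (0:ℝ) < k := by exact_mod_cast hk
  have fm := hf.continuous.abs.measurable
  have m1 : MeasurableSet {x | (2:ℝ) ^ k ≤ |f x|} := measurableSet_le measurable_const fm
  have m2 : MeasurableSet {x | (2:ℝ) ^ k ≤ |f x| ∧ |f x| < 2 ^ (k + 1)} :=
    m1.inter (measurableSet_lt fm measurable_const)
  have iD : Integrable (fun x => Real.exp (-(a * rho x)) * ‖fderiv ℝ f x‖ ^ 2) μ :=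
    exp_int (cs_grad_int hf hs) ha.le
  have i1 : Integrable (fun x => (if (2:ℝ) ^ k ≤ |f x| then (4:ℝ) ^ k else 0)) μ := by
    exact ite_int (integrable_const (μ := μ) ((4:ℝ) ^ k)) m1
  have i2 : Integrable (fun x => (if (2:ℝ) ^ k ≤ |f x| ∧ |f x| < 2 ^ (k + 1) then (1:ℝ) else 0) *
          (Real.exp (-(a * rho x)) * ‖fderiv ℝ f x‖ ^ 2)) μ := by
    have := ite_int iD m2
    refine this.congr (Filter.Eventually.of_forall fun x => ?_)
    show (if _ then _ else _) = (if _ then _ else _) * _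
    split_ifs <;> simp
  have mk := markov_lev hf.continuous hs h1 k
  have hq : 0 < k / (2 * c) := by positivity
  have key := key_SP hSP hq (gk_cd a hf k) (gk_cs a hs k) m1 (by
    intro x hx
    simp only [mem_ofPred_eq, not_le] at hx
    exact gk_zero a hx.le) (by
    have e1 : c * (1 + k / (2 * c)) = c + k / 2 := by field_simp
    rw [e1]
    have e2 : Real.exp k ≤ 4 ^ k := by
      rw [← Real.exp_one_pow]
      gcongr
      have := Real.exp_one_lt_d9
      linarith
    have e3 : Real.exp (c + k / 2) ≤ 1 / 2 * Real.exp k := by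
      have : Real.exp (c + k / 2) * Real.exp 1 ≤ Real.exp k := by
        rw [← Real.exp_add]; apply Real.exp_le_exp.2; linarith
      have h2 := Real.add_one_le_exp (1:ℝ)
      have h3 := Real.exp_pos (c + k / 2)
      nlinarith
    calc _ ≤ 1 / 2 * (4:ℝ) ^ k * μ.real {x | (2:ℝ) ^ k ≤ |f x|} := by
          gcongr; linarith
      _ ≤ 1 / 2 := by rw [mul_assoc]; linarith)
  have b : ∫ x, (4:ℝ) ^ k / k * ‖fderiv ℝ (gk a f k) x‖ ^ 2 ∂μ ≤ ∫ x, 32 * L ^ 2 * Real.exp a *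
      ((if (2:ℝ) ^ k ≤ |f x| then 4 ^ k else 0) +
        (if (2:ℝ) ^ k ≤ |f x| ∧ |f x| < 2 ^ (k + 1) then 1 else 0) *
          (Real.exp (-(a * rho x)) * ‖fderiv ℝ f x‖ ^ 2)) ∂μ := by
    apply integral_mono ((cs_grad_int (gk_cd a hf k) (gk_cs a hs k)).const_mul _)
      ((i1.add i2).const_mul _)
    intro x
    exact gk_grad hL hL1 ha hf hk x
  rw [integral_const_mul, integral_const_mul] at b
  calc k * 4 ^ k * ∫ x, gk a f k x ^ 2 ∂μ ≤ k * 4 ^ k * (2 * ((k / (2 * c)) ^ 2)⁻¹ *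
        ∫ x, ‖fderiv ℝ (gk a f k) x‖ ^ 2 ∂μ) := by gcongr
    _ = 8 * c ^ 2 * ((4:ℝ) ^ k / k * ∫ x, ‖fderiv ℝ (gk a f k) x‖ ^ 2 ∂μ) := by
        field_simp; ring
    _ ≤ _ := by
        have := mul_le_mul_of_nonneg_left b (by positivity : 0 ≤ 8 * c ^ 2)
        linarith

lemma gk_sum {μ : Measure E} [IsProbabilityMeasure μ] {c : ℝ} (hc : 0 < c) (hSP : SPI μ c)
    {L : ℝ} (hL : ∀ t, |deriv T t| ≤ L) (hL1 : 1 ≤ L) {a : ℝ} (ha : 0 < a) {f : E → ℝ}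
    (hf : ContDiff ℝ (⊤ : ℕ∞) f) (hs : HasCompactSupport f) (h1 : ∫ x, f x ^ 2 ∂μ = 1)
    {k0 : ℕ} (hk : 1 ≤ k0) (hkc : 2 * c + 2 ≤ k0) (K : ℕ) :
    ∫ x, ∑ k ∈ Finset.Ico k0 K, 96 * (k * 4 ^ k * gk a f k x ^ 2) ∂μ ≤
      96 * (256 * c ^ 2 * L ^ 2 * Real.exp a) * (2 * ∫ x, (if 2 ≤ |f x| then |f x| ^ 2 else 0) ∂μ +
        ∫ x, Real.exp (-(a * rho x)) * ‖fderiv ℝ f x‖ ^ 2 ∂μ) := by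
  have fm := hf.continuous.abs.measurable
  have iD : Integrable (fun x => Real.exp (-(a * rho x)) * ‖fderiv ℝ f x‖ ^ 2) μ :=
    exp_int (cs_grad_int hf hs) ha.le
  have m1 : ∀ k : ℕ, MeasurableSet {x | (2:ℝ) ^ k ≤ |f x|} :=
    fun k => measurableSet_le measurable_const fm
  have m2 : ∀ k : ℕ, MeasurableSet {x | (2:ℝ) ^ k ≤ |f x| ∧ |f x| < 2 ^ (k + 1)} :=
    fun k => (m1 k).inter (measurableSet_lt fm measurable_const)
  have i1 : ∀ k : ℕ, Integrable (fun x => (if (2:ℝ) ^ k ≤ |f x| then (4:ℝ) ^ k else 0)) μ := by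
    intro k
    exact ite_int (integrable_const (μ := μ) ((4:ℝ) ^ k)) (m1 k)
  have i2 : ∀ k : ℕ, Integrable (fun x =>
      (if (2:ℝ) ^ k ≤ |f x| ∧ |f x| < 2 ^ (k + 1) then (1:ℝ) else 0) *
          (Real.exp (-(a * rho x)) * ‖fderiv ℝ f x‖ ^ 2)) μ := by
    intro k
    have := ite_int iD (m2 k)
    refine this.congr (Filter.Eventually.of_forall fun x => ?_)
    show (if _ then _ else _) = (if _ then _ else _) * _
    split_ifs <;> simp
  have i3 : Integrable (fun x => if 2 ≤ |f x| then |f x| ^ 2 else 0) μ := by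
    have m3 : MeasurableSet {x | 2 ≤ |f x|} := measurableSet_le measurable_const fm
    simp only [sq_abs]
    exact ite_int (cs_sq_int (μ := μ) hf.continuous hs) m3
  have gi : ∀ k, Integrable (fun x => 96 * (k * 4 ^ k * gk a f k x ^ 2)) μ := fun k =>
    ((cs_sq_int (gk_cd a hf k).continuous (gk_cs a hs k)).const_mul _).const_mul _
  rw [integral_finsetSum _ fun k _ => gi k]
  have st : ∀ k ∈ Finset.Ico k0 K, ∫ x, 96 * (k * 4 ^ k * gk a f k x ^ 2) ∂μ ≤
      96 * (256 * c ^ 2 * L ^ 2 * Real.exp a) *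
      ∫ x, ((if (2:ℝ) ^ k ≤ |f x| then 4 ^ k else 0) +
        (if (2:ℝ) ^ k ≤ |f x| ∧ |f x| < 2 ^ (k + 1) then 1 else 0) *
          (Real.exp (-(a * rho x)) * ‖fderiv ℝ f x‖ ^ 2)) ∂μ := by
    intro k hk'
    have hkk := (Finset.mem_Ico.1 hk').1
    have hkr : (k0:ℝ) ≤ k := by exact_mod_cast hkk
    have := gk_int hc hSP hL hL1 ha hf hs h1 (hk.trans hkk) (hkc.trans hkr)
    rw [integral_const_mul, integral_const_mul]
    linarith
  refine (Finset.sum_le_sum st).trans ?_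
  have es := integral_finsetSum (μ := μ) (Finset.Ico k0 K) fun k _ => (i1 k).add (i2 k)
  simp only [Pi.add_apply] at es
  rw [← Finset.mul_sum, ← es]
  apply mul_le_mul_of_nonneg_left _ (by positivity)
  rw [← integral_const_mul, ← integral_add (i3.const_mul 2) iD]
  apply integral_mono (integrable_finsetSum _ fun k _ => (i1 k).add (i2 k)) ((i3.const_mul 2).add iD)
  intro x
  show ∑ k ∈ Finset.Ico k0 K, _ ≤ 2 * (if 2 ≤ |f x| then |f x| ^ 2 else 0) + _
  simp only [Pi.add_apply, Finset.sum_add_distrib, ← Finset.sum_mul]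
  have s1 := sum_lev1 |f x| k0 hk K (abs_nonneg _)
  have s2 := sum_lev2 |f x| k0 K
  have p : 0 ≤ Real.exp (-(a * rho x)) * ‖fderiv ℝ f x‖ ^ 2 := by positivity
  have := mul_le_mul_of_nonneg_right s2 p
  linarith

lemma log_pt {a : ℝ} (ha : 0 < a) (f : E → ℝ) {k0 : ℕ} (hk : 1 ≤ k0) {K : ℕ} {x : E}
    (hK : |f x| < 2 ^ (K + 1)) :
    f x ^ 2 * Real.log (f x ^ 2) ≤ (f x ^ 2 - 1) + (2 * 2 ^ (k0 + 1) + 1) * (|f x| - 1) ^ 2 +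
      6 * (Real.exp (a * rho x) * big (f x) ^ 2) +
      ∑ k ∈ Finset.Ico k0 K, 96 * (k * 4 ^ k * gk a f k x ^ 2) := by
  have S0 : ∀ k ∈ Finset.Ico k0 K, 0 ≤ 96 * (k * 4 ^ k * gk a f k x ^ 2) := by
    intro k _; positivity
  have S1 := Finset.sum_nonneg S0
  have B0 : 0 ≤ 6 * (Real.exp (a * rho x) * big (f x) ^ 2) := by positivity
  by_cases h : |f x| ≤ 2 ^ (k0 + 1)
  · have := ent_pt (one_le_pow₀ (by norm_num : (1:ℝ) ≤ 2)) h
    linarith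
  push Not at h
  have W0 : 0 ≤ (2 * (2:ℝ) ^ (k0 + 1) + 1) * (|f x| - 1) ^ 2 := by positivity
  have h4 : (4:ℝ) ≤ 2 ^ (k0 + 1) := by
    calc (4:ℝ) = 2 ^ (1 + 1) := by norm_num
      _ ≤ _ := pow_le_pow_right₀ (by norm_num) (by omega)
  have f4 : 4 ≤ |f x| := h4.trans h.le
  have F0 : 0 ≤ f x ^ 2 - 1 := by rw [← sq_abs]; nlinarith
  obtain ⟨n, hn1, hn2⟩ := exists_nat_pow_near (by linarith : 1 ≤ |f x|) (by norm_num : (1:ℝ) < 2)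
  have n1 : k0 + 1 ≤ n := by
    by_contra hh
    have : (2:ℝ) ^ (n + 1) ≤ 2 ^ (k0 + 1) := pow_le_pow_right₀ (by norm_num) (by omega)
    linarith
  have n2 : n < K + 1 := by
    by_contra hh
    have : (2:ℝ) ^ (K + 1) ≤ 2 ^ n := pow_le_pow_right₀ (by norm_num) (by omega)
    linarith
  obtain ⟨k, rfl⟩ : ∃ k, n = k + 1 := ⟨n - 1, by omega⟩
  have hkm : k ∈ Finset.Ico k0 K := Finset.mem_Ico.2 ⟨by omega, by omega⟩
  have k1 : (1:ℝ) ≤ k := by exact_mod_cast (by omega : 1 ≤ k)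
  have hlog : Real.log (f x ^ 2) ≤ 6 * k := by
    rw [← sq_abs, Real.log_pow]
    have : Real.log |f x| ≤ (k + 2) * Real.log 2 := by
      have e : ((k:ℝ) + 2) * Real.log 2 = Real.log (2 ^ (k + 1 + 1)) := by
        rw [Real.log_pow]; push_cast; ring
      rw [e]
      exact Real.log_le_log (by linarith) hn2.le
    have l2 := Real.log_two_lt_d9
    have l20 : 0 < Real.log 2 := Real.log_pos (by norm_num)
    push_cast
    nlinarith
  by_cases hke : (k:ℝ) ≤ Real.exp (a * rho x)
  · have : f x ^ 2 * Real.log (f x ^ 2) ≤ 6 * (Real.exp (a * rho x) * big (f x) ^ 2) := by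
      rw [big_eq f4]
      calc _ ≤ f x ^ 2 * (6 * Real.exp (a * rho x)) := by
            apply mul_le_mul_of_nonneg_left _ (sq_nonneg _); linarith
        _ = _ := by ring
    linarith
  · push Not at hke
    have hg : gk a f k x = 1 := by
      rw [gk, lev_one, cut_one, one_mul]
      · have : a * rho x < Real.log k := (Real.lt_log_iff_exp_lt (by linarith)).2 hke
        have : rho x ≤ Real.log k / a := by rw [le_div_iff₀ ha]; linarith
        linarith
      · rw [abs_div, abs_of_pos (by positivity : (0:ℝ) < 2 ^ k), le_div_iff₀ (by positivity)]
        rw [pow_succ] at hn1; linarith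
    have hle := Finset.single_le_sum S0 hkm
    simp only [hg, one_pow, mul_one] at hle
    have f16 : f x ^ 2 ≤ 16 * 4 ^ k := by
      have : |f x| ^ 2 ≤ (2 ^ (k + 1 + 1)) ^ 2 := by gcongr
      rw [sq_abs] at this
      have e : ((2:ℝ) ^ (k + 1 + 1)) ^ 2 = 16 * 4 ^ k := by
        have h4 : (4:ℝ) ^ k = (2 ^ k) ^ 2 := by rw [← pow_mul, mul_comm, pow_mul]; norm_num
        rw [h4]; ring
      linarith
    have : f x ^ 2 * Real.log (f x ^ 2) ≤ 96 * (k * 4 ^ k) := by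
      calc _ ≤ f x ^ 2 * (6 * k) := mul_le_mul_of_nonneg_left hlog (sq_nonneg _)
        _ ≤ (16 * 4 ^ k) * (6 * k) := by gcongr
        _ = _ := by ring
    linarith

lemma main_ls {V : E → ℝ} (hV : Continuous V) {μ : Measure E} [IsProbabilityMeasure μ]
    (hμ : μ = volume.withDensity (fun x => ENNReal.ofReal (Real.exp (V x))))
    {c : ℝ} (hc : 0 < c) (hSP : SPI μ c) :
    ∃ C > (0:ℝ), ∃ a > (0:ℝ), ∀ f : E → ℝ, ContDiff ℝ (⊤ : ℕ∞) f → HasCompactSupport f →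
      ∫ x, f x ^ 2 ∂μ = 1 → ∫ x, f x ^ 2 * Real.log (f x ^ 2) ∂μ ≤
        C * ∫ x, Real.exp (-(a * rho x)) * ‖fderiv ℝ f x‖ ^ 2 ∂μ := by
  obtain ⟨L, hL1, hL⟩ := T_deriv_bdd
  obtain ⟨a, ha, C0, hC0, n0, hann⟩ := annulus hc hSP
  obtain ⟨K1, hK1, hH⟩ := hardy (μ := μ) ha hC0 hann
  obtain ⟨K2, hK2, hP⟩ := wpoinc hV hμ ha hC0 hann
  obtain ⟨k0, hk0⟩ := exists_nat_ge (2 * c + 2)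
  have hk01 : 1 ≤ k0 := by
    have : (1:ℝ) ≤ k0 := by linarith
    exact_mod_cast this
  set M := 96 * (256 * c ^ 2 * L ^ 2 * Real.exp a) with hM
  have M0 : 0 < M := by positivity
  refine ⟨(2 * 2 ^ (k0 + 1) + 1) * K2 + 6 * (K1 * (81 * L ^ 2 + 4 * K2)) + M * (8 * K2 + 1),
    by positivity, a, ha, ?_⟩
  intro f hf hs h1
  have fm := hf.continuous.abs.measurable
  have fc := hf.continuous
  have rc := (rho_cd (d := d)).continuous
  have iD : Integrable (fun x => Real.exp (-(a * rho x)) * ‖fderiv ℝ f x‖ ^ 2) μ :=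
    exp_int (cs_grad_int hf hs) ha.le
  have i3 : Integrable (fun x => if 2 ≤ |f x| then |f x| ^ 2 else 0) μ := by
    have m3 : MeasurableSet {x | 2 ≤ |f x|} := measurableSet_le measurable_const fm
    simp only [sq_abs]
    exact ite_int (cs_sq_int (μ := μ) hf.continuous hs) m3
  have iW : Integrable (fun x => (|f x| - 1) ^ 2) μ := by
    have : (fun x => (|f x| - 1) ^ 2) = fun x => f x ^ 2 - 2 * |f x| + 1 := by
      funext x; rw [← sq_abs (f x)]; ring
    rw [this]
    exact ((cs_sq_int fc hs).sub ((int_cs fc hs).abs.const_mul 2)).add (integrable_const _)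
  have uS : ContDiff ℝ (⊤ : ℕ∞) (fun x => big (f x)) := big_cd.comp hf
  have uc : HasCompactSupport (fun x => big (f x)) :=
    hs.comp_left (g := big) (big_zero (by simp))
  have hHu := hH _ uS uc
  have hPf := hP f hf hs h1
  set D := ∫ x, Real.exp (-(a * rho x)) * ‖fderiv ℝ f x‖ ^ 2 ∂μ
  have hF2 : ∫ x, (if 2 ≤ |f x| then |f x| ^ 2 else 0) ∂μ ≤ 4 * ∫ x, (|f x| - 1) ^ 2 ∂μ := by
    rw [← integral_const_mul]
    apply integral_mono i3 (iW.const_mul 4)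
    intro x
    show (if 2 ≤ |f x| then |f x| ^ 2 else 0) ≤ 4 * (|f x| - 1) ^ 2
    split_ifs with h
    · nlinarith
    · positivity
  have hu2 : ∫ x, big (f x) ^ 2 ∂μ ≤ ∫ x, (if 2 ≤ |f x| then |f x| ^ 2 else 0) ∂μ := by
    apply integral_mono (cs_sq_int uS.continuous uc) i3
    intro x
    show big (f x) ^ 2 ≤ (if 2 ≤ |f x| then |f x| ^ 2 else 0)
    split_ifs with h
    · rw [sq_abs]; exact big_sq_le _
    · push Not at h
      rw [big_zero h.le]; simp
  have hug : ∫ x, Real.exp (-(a * rho x)) * ‖fderiv ℝ (fun x => big (f x)) x‖ ^ 2 ∂μ ≤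
      81 * L ^ 2 * D := by
    rw [← integral_const_mul]
    apply integral_mono (exp_int (cs_grad_int uS uc) ha.le) (iD.const_mul _)
    intro x
    show Real.exp (-(a * rho x)) * ‖fderiv ℝ (fun x => big (f x)) x‖ ^ 2 ≤
      81 * L ^ 2 * (Real.exp (-(a * rho x)) * ‖fderiv ℝ f x‖ ^ 2)
    rw [fderiv_comp_scalar big_cd hf x]
    have := big_deriv_le hL hL1 (f x)
    calc _ ≤ Real.exp (-(a * rho x)) * (9 * L * ‖fderiv ℝ f x‖) ^ 2 := by gcongr
      _ = _ := by ring
  obtain ⟨B, hB⟩ := hs.exists_bound_of_continuous fc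
  obtain ⟨K, hKB⟩ := pow_unbounded_of_one_lt B (by norm_num : (1:ℝ) < 2)
  have hKx : ∀ x, |f x| < 2 ^ (K + 1) := by
    intro x
    have := hB x
    rw [Real.norm_eq_abs] at this
    have : (2:ℝ) ^ K ≤ 2 ^ (K + 1) := pow_le_pow_right₀ (by norm_num) (by omega)
    linarith
  have hS := gk_sum hc hSP hL hL1 ha hf hs h1 hk01 hk0 K
  have iS : Integrable (fun x => ∑ k ∈ Finset.Ico k0 K, 96 * (k * 4 ^ k * gk a f k x ^ 2)) μ :=
    integrable_finsetSum _ fun k _ =>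
      ((cs_sq_int (gk_cd a hf k).continuous (gk_cs a hs k)).const_mul _).const_mul _
  have iF : Integrable (fun x => f x ^ 2 - 1) μ := (cs_sq_int fc hs).sub (integrable_const _)
  have iU : Integrable (fun x => Real.exp (a * rho x) * big (f x) ^ 2) μ := by
    apply int_cs
    · have := uS.continuous
      fun_prop
    · obtain ⟨N, hN⟩ := cs_bdd uc
      apply hcs_of_rho (R := N)
      intro x hx
      simp [hN x hx]
  have iL : Integrable (fun x => f x ^ 2 * Real.log (f x ^ 2)) μ := by
    apply int_cs
    · exact Real.continuous_mul_log.comp (fc.pow 2)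
    · exact hs.comp_left (g := fun t : ℝ => t ^ 2 * Real.log (t ^ 2)) (by simp)
  have tot : ∫ x, f x ^ 2 * Real.log (f x ^ 2) ∂μ ≤
      ∫ x, ((f x ^ 2 - 1) + (2 * 2 ^ (k0 + 1) + 1) * (|f x| - 1) ^ 2 +
      6 * (Real.exp (a * rho x) * big (f x) ^ 2) +
      ∑ k ∈ Finset.Ico k0 K, 96 * (k * 4 ^ k * gk a f k x ^ 2)) ∂μ := by
    apply integral_mono iL (((iF.add (iW.const_mul _)).add (iU.const_mul _)).add iS)
    intro x
    exact log_pt ha f hk01 (hKx x)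
  have j1 := iF.add (iW.const_mul (2 * 2 ^ (k0 + 1) + 1))
  have j2 := j1.add (iU.const_mul 6)
  have e1 := integral_add j2 iS
  have e2 := integral_add j1 (iU.const_mul 6)
  have e3 := integral_add iF (iW.const_mul (2 * 2 ^ (k0 + 1) + 1))
  have e4 : ∫ x, (f x ^ 2 - 1) ∂μ = 0 := by
    rw [integral_sub (cs_sq_int fc hs) (integrable_const _), h1]; simp
  simp only [Pi.add_apply] at e1 e2 e3
  rw [e1, e2, e3, e4, integral_const_mul, integral_const_mul] at tot
  set W := ∫ x, (|f x| - 1) ^ 2 ∂μ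
  set F2 := ∫ x, (if 2 ≤ |f x| then |f x| ^ 2 else 0) ∂μ
  have q1 : (2 * (2:ℝ) ^ (k0 + 1) + 1) * W ≤ (2 * 2 ^ (k0 + 1) + 1) * (K2 * D) := by gcongr
  have q2 : F2 ≤ 4 * (K2 * D) := by linarith
  have q3 := hHu.trans (mul_le_mul_of_nonneg_left
    (add_le_add hug (hu2.trans q2)) hK1.le)
  have q4 : M * (2 * F2 + D) ≤ M * (2 * (4 * (K2 * D)) + D) := by gcongr
  calc _ ≤ _ := tot
    _ ≤ 0 + (2 * 2 ^ (k0 + 1) + 1) * (K2 * D) + 6 * (K1 * (81 * L ^ 2 * D + 4 * (K2 * D))) +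
        M * (2 * (4 * (K2 * D)) + D) := by
        have := hS.trans q4
        linarith
    _ = _ := by ring

end

theorem stmt6 (d : ℕ)
    (V : EuclideanSpace ℝ (Fin d) → ℝ) (hV : Continuous V)
    (hV1 : ∫ x, Real.exp (V x) = 1)
    (μ : Measure (EuclideanSpace ℝ (Fin d)))
    (hμ : μ = volume.withDensity (fun x => ENNReal.ofReal (Real.exp (V x))))
    (c : ℝ) (hc : 0 < c)
    (hSP : ∀ r > (0:ℝ), ∀ f : EuclideanSpace ℝ (Fin d) → ℝ,
      ContDiff ℝ (⊤ : ℕ∞) f → HasCompactSupport f →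
      ∫ x, f x ^ 2 ∂μ ≤ r * ∫ x, ‖gradient f x‖ ^ 2 ∂μ
        + Real.exp (c * (1 + r ^ (-(1:ℝ)/2))) * (∫ x, |f x| ∂μ) ^ 2) :
    ∃ C > (0:ℝ), ∃ c₁ > (0:ℝ), ∀ f : EuclideanSpace ℝ (Fin d) → ℝ,
      ContDiff ℝ (⊤ : ℕ∞) f → HasCompactSupport f → ∫ x, f x ^ 2 ∂μ = 1 →
      ∫ x, f x ^ 2 * Real.log (f x ^ 2) ∂μ ≤
        C * ∫ x, Real.exp (-c₁ * ‖x‖) * ‖gradient f x‖ ^ 2 ∂μ := by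
  have hi : Integrable (fun x => Real.exp (V x)) := by
    by_contra h
    rw [integral_undef h] at hV1
    exact zero_ne_one hV1
  have : IsProbabilityMeasure μ := by
    constructor
    rw [hμ, withDensity_apply _ MeasurableSet.univ, Measure.restrict_univ,
      ← ofReal_integral_eq_lintegral_ofReal hi
        (Filter.Eventually.of_forall fun x => (Real.exp_pos _).le), hV1, ENNReal.ofReal_one]
  have hg : ∀ (f : EuclideanSpace ℝ (Fin d) → ℝ) x, ‖gradient f x‖ = ‖fderiv ℝ f x‖ := by
    intro f x
    rw [gradient, LinearIsometryEquiv.norm_map]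
  simp only [hg] at hSP ⊢
  have hS : SPI μ c := by
    intro q hq f hf hs
    have h := hSP ((q ^ 2)⁻¹) (by positivity) f hf hs
    have e : ((q ^ 2)⁻¹ : ℝ) ^ (-(1:ℝ) / 2) = q := by
      rw [neg_div, Real.rpow_neg (by positivity), ← Real.sqrt_eq_rpow, Real.sqrt_inv,
        Real.sqrt_sq hq.le, inv_inv]
    rwa [e] at h
  obtain ⟨C, hC, a, ha, H⟩ := main_ls hV hμ hc hS
  refine ⟨C, hC, a, ha, ?_⟩
  intro f hf hs h1
  refine (H f hf hs h1).trans ?_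
  apply mul_le_mul_of_nonneg_left _ hC.le
  apply integral_mono (exp_int (cs_grad_int hf hs) ha.le)
  · apply int_cs
    · have := cd_norm_cont hf
      fun_prop
    · have h2 : HasCompactSupport (fun x => ‖fderiv ℝ f x‖ ^ 2) :=
        (hs.fderiv ℝ).comp_left (g := fun t : EuclideanSpace ℝ (Fin d) →L[ℝ] ℝ => ‖t‖ ^ 2) (by simp)
      exact h2.mul_left
  · intro x
    show Real.exp (-(a * rho x)) * ‖fderiv ℝ f x‖ ^ 2 ≤ Real.exp (-a * ‖x‖) * ‖fderiv ℝ f x‖ ^ 2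
    have := norm_le_rho x
    apply mul_le_mul_of_nonneg_right _ (sq_nonneg _)
    apply Real.exp_le_exp.2
    nlinarith
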